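/- Every 7-vertex 3-dimensional Z₂-acyclic simplicial complex is collapsible. -/

import Mathlib

/- Formalization of definitions from:
   B. Bagchi, B. Datta, "Combinatorial triangulations of homology spheres". -/

open Finset

noncomputable section

attribute [local instance] Classical.propDecidable

namespace HomologySpheres

variable {V : Type*} [DecidableEq V] {W : Type*} [DecidableEq W]

/-- The vertex set of a finite family of finite sets. -/
def verts (K : Finset (Finset V)) : Finset V := K.sup id

/-- An (abstract, finite) simplicial complex: a nonempty collection of nonempty
finite sets closed under taking nonempty subsets. -/
def IsComplex (K : Finset (Finset V)) : Prop :=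
  K.Nonempty ∧ ∅ ∉ K ∧ ∀ s ∈ K, ∀ t : Finset V, t ⊆ s → t.Nonempty → t ∈ K

/-- The facets (maximal faces) of `K`. -/
def facets (K : Finset (Finset V)) : Finset (Finset V) :=
  K.filter fun s => ∀ t ∈ K, s ⊆ t → t = s

/-- `K` is pure of dimension `d`: every maximal face has `d + 1` vertices. -/
def IsPure (d : ℕ) (K : Finset (Finset V)) : Prop :=
  ∀ s ∈ facets K, s.card = d + 1

/-- The link of a face `σ` in `K`. -/
def link (K : Finset (Finset V)) (σ : Finset V) : Finset (Finset V) :=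
  K.filter fun τ => Disjoint τ σ ∧ τ ∪ σ ∈ K

/-- `L` is an induced (full) subcomplex of `K`. -/
def IsInduced (K L : Finset (Finset V)) : Prop :=
  L ⊆ K ∧ ∀ s ∈ K, s ⊆ verts L → s ∈ L

/-- The simplicial complement `C(L, K)`: the induced subcomplex of `K` on
`V(K) \ V(L)`. -/
def simpComplement (L K : Finset (Finset V)) : Finset (Finset V) :=
  K.filter fun s => s ⊆ verts K \ verts L

/-- The simplicial neighbourhood `N(L, K)`: the subcomplex of `K` whose maximal
faces are the maximal faces of `K` meeting `V(L)`. -/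
def simpNbhd (L K : Finset (Finset V)) : Finset (Finset V) :=
  K.filter fun s => ∃ t ∈ facets K, s ⊆ t ∧ (t ∩ verts L).Nonempty

/-- `fvec K i` is the number of `i`-dimensional faces of `K`. -/
def fvec (K : Finset (Finset V)) (i : ℕ) : ℕ :=
  (K.filter fun s => s.card = i + 1).card

/-- The number of facets of cardinality `d + 1` containing a given `(d-1)`-face
(the degree of the face in a (weak) pseudomanifold of dimension `d`). -/
def degOf (K : Finset (Finset V)) (d : ℕ) (s : Finset V) : ℕ :=
  (K.filter fun t => s ⊆ t ∧ t.card = d + 1).card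

/-- Simplicial isomorphism (via a vertex bijection carrying faces to faces). -/
def Iso (K : Finset (Finset V)) (L : Finset (Finset W)) : Prop :=
  ∃ f : V → W, Set.InjOn f ↑(verts K) ∧ L = K.image (Finset.image f)

/-- The join of two simplicial complexes (on disjoint vertex sets). -/
def sjoin (K L : Finset (Finset V)) : Finset (Finset V) :=
  K ∪ L ∪ (K ×ˢ L).image fun p => p.1 ∪ p.2

/-- The standard ball on vertex set `A`: all nonempty subsets of `A`. -/
def stdBall (A : Finset V) : Finset (Finset V) := A.powerset.erase ∅

/-- The standard sphere on vertex set `A`: all nonempty proper subsets of `A`. -/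
def stdSphere (A : Finset V) : Finset (Finset V) := (A.powerset.erase ∅).erase A

/-- `τ` is a free face of `K`, with `σ` the unique face properly containing it. -/
def IsFreeFace (K : Finset (Finset V)) (τ σ : Finset V) : Prop :=
  τ ∈ K ∧ σ ∈ K ∧ τ ⊂ σ ∧ ∀ ρ ∈ K, τ ⊂ ρ → ρ = σ

/-- An elementary collapse removes a free face together with the unique face
properly containing it. -/
def ElemCollapse (K K' : Finset (Finset V)) : Prop :=
  ∃ τ σ : Finset V, IsFreeFace K τ σ ∧ K' = (K.erase τ).erase σ

/-- `K` collapses to `L` by a sequence of elementary collapses. -/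
def CollapsesTo (K L : Finset (Finset V)) : Prop :=
  Relation.ReflTransGen ElemCollapse K L

/-- `K` is collapsible: it collapses to a single vertex. -/
def Collapsible (K : Finset (Finset V)) : Prop :=
  ∃ v : V, CollapsesTo K {{v}}

/-! ### Simplicial homology with `ℤ/2` coefficients (augmented chain complex).
A chain of level `n` is a `ZMod 2`-valued function supported on the faces of
cardinality `n` (the empty set, of cardinality `0`, serves as the `(-1)`-simplex
of the augmented complex).  Reduced homology in dimension `q` lives at level
`q + 1`. -/

/-- `c` is a chain of level `n` of `K` (over `ℤ/2`). -/
def z2chainOK (K : Finset (Finset V)) (n : ℕ) (c : Finset V → ZMod 2) : Prop :=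
  ∀ s : Finset V, c s ≠ 0 → s.card = n ∧ (s ∈ K ∨ s = ∅)

/-- The mod-2 boundary operator. -/
def z2bdry (K : Finset (Finset V)) (c : Finset V → ZMod 2) : Finset V → ZMod 2 :=
  fun t => ∑ v ∈ verts K \ t, c (insert v t)

/-- `K` is `ℤ/2`-acyclic: all reduced homology with `ℤ/2` coefficients vanishes,
i.e. in the augmented mod-2 chain complex every cycle is a boundary. -/
def Z2Acyclic (K : Finset (Finset V)) : Prop :=
  ∀ (n : ℕ) (c : Finset V → ZMod 2), z2chainOK K n c → z2bdry K c = 0 →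
    ∃ c', z2chainOK K (n + 1) c' ∧ z2bdry K c' = c

/-- `K` has the reduced `ℤ/2`-homology of the `d`-sphere: reduced homology
vanishes in all dimensions except `d` (level `d + 1`), where it is `ℤ/2`
(there is a cycle `z` which is not a boundary, and modulo boundaries every
cycle is `0` or `z`). -/
def Z2HomologySphere (d : ℕ) (K : Finset (Finset V)) : Prop :=
  (∀ (n : ℕ) (c : Finset V → ZMod 2), n ≠ d + 1 → z2chainOK K n c →
    z2bdry K c = 0 → ∃ c', z2chainOK K (n + 1) c' ∧ z2bdry K c' = c) ∧
  (∃ z : Finset V → ZMod 2, z2chainOK K (d + 1) z ∧ z2bdry K z = 0 ∧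
    (∀ c', z2chainOK K (d + 2) c' → z2bdry K c' ≠ z) ∧
    (∀ z', z2chainOK K (d + 1) z' → z2bdry K z' = 0 →
      (∃ c', z2chainOK K (d + 2) c' ∧ z2bdry K c' = z') ∨
      (∃ c', z2chainOK K (d + 2) c' ∧ z2bdry K c' = z + z')))

/-! ### Integral simplicial homology via ordered chains (Munkres §13: ordered
simplicial homology, allowing repeated vertices, agrees with simplicial
homology). An ordered `m`-tuple chain corresponds to dimension `m - 1`; the
unique `0`-tuple is the `(-1)`-simplex of the augmented complex. -/

/-- `c` is an ordered chain of `K` over `ℤ`: supported on tuples whose image is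
a face (the empty tuple being allowed in level `0`). -/
def zchainOK (K : Finset (Finset V)) {m : ℕ} (c : (Fin m → V) → ℤ) : Prop :=
  ∀ x : Fin m → V, c x ≠ 0 → (Finset.univ.image x ∈ K ∨ m = 0)

/-- The integral boundary operator on ordered chains. -/
def zbdry (K : Finset (Finset V)) {m : ℕ} (c : (Fin (m + 1) → V) → ℤ) :
    (Fin m → V) → ℤ :=
  fun y => ∑ i : Fin (m + 1), (-1 : ℤ) ^ (i : ℕ) * ∑ v ∈ verts K, c (i.insertNth v y)

/-- `K` has the reduced integral homology of the `d`-sphere: reduced homology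
vanishes in all dimensions except `d`, where it is infinite cyclic (there is a
cycle `z` such that every cycle is, modulo boundaries, a unique multiple of `z`). -/
def ZHomologySphere (d : ℕ) (K : Finset (Finset V)) : Prop :=
  (∀ c : (Fin 0 → V) → ℤ, ∃ c' : (Fin 1 → V) → ℤ, zchainOK K c' ∧ zbdry K c' = c) ∧
  (∀ (m : ℕ) (c : (Fin (m + 1) → V) → ℤ), m ≠ d → zchainOK K c → zbdry K c = 0 →
    ∃ c' : (Fin (m + 2) → V) → ℤ, zchainOK K c' ∧ zbdry K c' = c) ∧
  (∃ z : (Fin (d + 1) → V) → ℤ, zchainOK K z ∧ zbdry K z = 0 ∧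
    ∀ z' : (Fin (d + 1) → V) → ℤ, zchainOK K z' → zbdry K z' = 0 →
      ∃! k : ℤ, ∃ c'' : (Fin (d + 2) → V) → ℤ,
        zchainOK K c'' ∧ zbdry K c'' = z' - k • z)

/-- A weak pseudomanifold of dimension `d`: pure, and every `(d-1)`-face is in
exactly two facets. -/
def IsWeakPseudomanifold (d : ℕ) (K : Finset (Finset V)) : Prop :=
  IsComplex K ∧ IsPure d K ∧ ∀ s ∈ K, s.card = d → degOf K d s = 2

/-- Adjacency of facets along a common `(d-1)`-face. -/
def FacetAdj (d : ℕ) (K : Finset (Finset V)) (s t : Finset V) : Prop :=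
  s ∈ K ∧ t ∈ K ∧ s.card = d + 1 ∧ t.card = d + 1 ∧ (s ∩ t).card = d

/-- A pseudomanifold: a weak pseudomanifold in which any two facets are joined
by a chain of facets, consecutive ones sharing a `(d-1)`-face. -/
def IsPseudomanifold (d : ℕ) (K : Finset (Finset V)) : Prop :=
  IsWeakPseudomanifold d K ∧ ∀ s ∈ K, ∀ t ∈ K, s.card = d + 1 → t.card = d + 1 →
    Relation.ReflTransGen (FacetAdj d K) s t

/-- A weak pseudomanifold with boundary. -/
def IsWeakPseudomanifoldWithBdry (d : ℕ) (K : Finset (Finset V)) : Prop :=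
  IsComplex K ∧ IsPure d K ∧
  (∀ s ∈ K, s.card = d → degOf K d s = 1 ∨ degOf K d s = 2) ∧
  (∃ s ∈ K, s.card = d ∧ degOf K d s = 1)

/-- The boundary complex: all faces of degree-one `(d-1)`-faces. -/
def bdryComplex (d : ℕ) (K : Finset (Finset V)) : Finset (Finset V) :=
  K.filter fun t => ∃ s ∈ K, t ⊆ s ∧ s.card = d ∧ degOf K d s = 1

/-- `K` is connected (any two vertices joined by a path of edges). -/
def SConnected (K : Finset (Finset V)) : Prop :=
  ∀ u ∈ verts K, ∀ v ∈ verts K,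
    Relation.ReflTransGen (fun a b : V => ({a, b} : Finset V) ∈ K) u v

/-! ### Geometric realizations, subdivisions and combinatorial equivalence. -/

/-- A geometric simplicial complex in `ℝ^ℕ`: finitely many geometric simplices
(affinely independent vertex sets), closed under faces, any two of which meet
in a common face. -/
structure GComplex where
  faces : Finset (Finset (ℕ → ℝ))
  nonempty : faces.Nonempty
  empty_not_mem : ∅ ∉ faces
  down_closed : ∀ s ∈ faces, ∀ t : Finset (ℕ → ℝ), t ⊆ s → t.Nonempty → t ∈ faces
  indep : ∀ s ∈ faces,
    AffineIndependent ℝ (fun x : {y : ℕ → ℝ // y ∈ s} => (x : ℕ → ℝ))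
  glue : ∀ s ∈ faces, ∀ t ∈ faces,
    convexHull ℝ (s : Set (ℕ → ℝ)) ∩ convexHull ℝ (t : Set (ℕ → ℝ)) =
      convexHull ℝ ((s ∩ t : Finset (ℕ → ℝ)) : Set (ℕ → ℝ))

/-- The geometric carrier (underlying polyhedron) of a geometric complex. -/
def GComplex.carrier (G : GComplex) : Set (ℕ → ℝ) :=
  ⋃ s ∈ G.faces, convexHull ℝ (s : Set (ℕ → ℝ))

/-- `G` realizes the abstract complex `K` via the vertex map `f`. -/
def RealizesMap (G : GComplex) (K : Finset (Finset V)) (f : V → ℕ → ℝ) : Prop :=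
  Set.InjOn f ↑(verts K) ∧ G.faces = K.image (Finset.image f)

/-- `G` is a geometric realization of the abstract complex `K`. -/
def Realizes (G : GComplex) (K : Finset (Finset V)) : Prop :=
  ∃ f : V → ℕ → ℝ, RealizesMap G K f

/-- `G'` is a subdivision of `G`: same carrier, and every simplex of `G'` is
contained in a simplex of `G`. -/
def Subdivides (G' G : GComplex) : Prop :=
  G'.carrier = G.carrier ∧
  ∀ s ∈ G'.faces, ∃ t ∈ G.faces,
    convexHull ℝ (s : Set (ℕ → ℝ)) ⊆ convexHull ℝ (t : Set (ℕ → ℝ))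

/-- Combinatorial equivalence: `K` and `L` admit isomorphic subdivisions. -/
def CombEquiv (K : Finset (Finset V)) (L : Finset (Finset W)) : Prop :=
  ∃ G1 G1' G2 G2' : GComplex, Realizes G1 K ∧ Realizes G2 L ∧
    Subdivides G1' G1 ∧ Subdivides G2' G2 ∧ Iso G1'.faces G2'.faces

/-- A combinatorial `d`-ball: combinatorially equivalent to the standard ball. -/
def IsCombBall (d : ℕ) (K : Finset (Finset V)) : Prop :=
  ∃ A : Finset ℕ, A.card = d + 1 ∧ CombEquiv K (stdBall A)

/-- A combinatorial `d`-sphere: combinatorially equivalent to the standard sphere. -/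
def IsCombSphere (d : ℕ) (K : Finset (Finset V)) : Prop :=
  ∃ A : Finset ℕ, A.card = d + 2 ∧ CombEquiv K (stdSphere A)

/-- A combinatorial `d`-manifold: every vertex link is a combinatorial
`(d-1)`-sphere. -/
def IsCombManifold (d : ℕ) (K : Finset (Finset V)) : Prop :=
  IsComplex K ∧ ∀ v ∈ verts K, IsCombSphere (d - 1) (link K {v})

/-- A combinatorial `d`-manifold with boundary. -/
def IsCombManifoldWithBdry (d : ℕ) (K : Finset (Finset V)) : Prop :=
  IsComplex K ∧
  (∀ v ∈ verts K, IsCombSphere (d - 1) (link K {v}) ∨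
    IsCombBall (d - 1) (link K {v})) ∧
  (∃ v ∈ verts K, IsCombBall (d - 1) (link K {v}))

/-- A pl `k`-ball: a polyhedron carried by some geometric complex whose face
structure is a combinatorial `k`-ball. -/
def IsPLBall (k : ℕ) (P : Set (ℕ → ℝ)) : Prop :=
  ∃ G : GComplex, G.carrier = P ∧ IsCombBall k G.faces

/-- Elementary polyhedral collapse: `P = P' ∪ B` with `B` a pl `k`-ball and
`P' ∩ B` a pl `(k-1)`-ball. -/
def PolyElemCollapse (P P' : Set (ℕ → ℝ)) : Prop :=
  ∃ k : ℕ, 1 ≤ k ∧ ∃ B : Set (ℕ → ℝ),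
    IsPLBall k B ∧ P = P' ∪ B ∧ IsPLBall (k - 1) (P' ∩ B)

/-- Polyhedral collapse. -/
def PolyCollapsesTo (P Q : Set (ℕ → ℝ)) : Prop :=
  Relation.ReflTransGen PolyElemCollapse P Q

/-- Carrier of a subcomplex under a vertex realization map `f`. -/
def subCarrier (f : V → ℕ → ℝ) (L : Finset (Finset V)) : Set (ℕ → ℝ) :=
  ⋃ s ∈ L, convexHull ℝ ((s.image f : Finset (ℕ → ℝ)) : Set (ℕ → ℝ))

/-! ### Bistellar moves. -/

/-- The core `β = {x ∈ A : A \ {x} ∈ X}` of a `(d+2)`-set `A`. -/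
def bcore (X : Finset (Finset V)) (A : Finset V) : Finset V :=
  A.filter fun x => A.erase x ∈ X

/-- `κ_A` is a bistellar `i`-move on the `d`-dimensional complex `X`:
`A` has `d + 2` elements and contains at least one and at most `d + 1` facets
of `X`; with `β` the core of `A` and `α = A \ β` an `i`-face of `X`, one has
`β ∉ X`, and either `α` is a facet of `X` or `Lk_X(α)` has vertex set `β`. -/
def BistellarIMove (d i : ℕ) (X : Finset (Finset V)) (A : Finset V) : Prop :=
  A.card = d + 2 ∧
  0 < ((facets X).filter fun σ => σ ⊆ A).card ∧
  ((facets X).filter fun σ => σ ⊆ A).card ≤ d + 1 ∧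
  bcore X A ∉ X ∧
  A \ bcore X A ∈ X ∧ (A \ bcore X A).card = i + 1 ∧
  (A \ bcore X A ∈ facets X ∨ verts (link X (A \ bcore X A)) = bcore X A)

/-! ### The explicit small complexes of the paper. -/

/-- The complex generated by a list of facets: all nonempty subsets thereof. -/
def genBy (F : Finset (Finset ℕ)) : Finset (Finset ℕ) :=
  F.sup fun s => s.powerset.erase ∅

/-- The standard 2-sphere `S²₄`. -/
def S24 : Finset (Finset ℕ) := stdSphere {1, 2, 3, 4}

/-- The join `S¹₃ * S⁰₂`. -/
def S13S02 : Finset (Finset ℕ) := sjoin (stdSphere {1, 2, 3}) (stdSphere {4, 5})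

/-- The octahedron `S⁰₂ * S⁰₂ * S⁰₂`. -/
def Octa : Finset (Finset ℕ) :=
  sjoin (stdSphere {1, 2}) (sjoin (stdSphere {3, 4}) (stdSphere {5, 6}))

/-- The 6-vertex real projective plane `ℝP²₆`. -/
def RP26 : Finset (Finset ℕ) :=
  genBy {{1, 2, 3}, {1, 2, 4}, {1, 3, 5}, {1, 4, 6}, {1, 5, 6},
         {2, 3, 6}, {2, 4, 5}, {2, 5, 6}, {3, 4, 5}, {3, 4, 6}}

/-- `Σ₁`: the 6-vertex 2-sphere with a vertex of degree 3 and one of degree 5. -/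
def Sigma1 : Finset (Finset ℕ) :=
  genBy {{1, 2, 5}, {1, 2, 6}, {1, 5, 6}, {2, 3, 5},
         {2, 3, 6}, {3, 4, 5}, {3, 4, 6}, {4, 5, 6}}

/-- The double pyramid `S¹₅ * S⁰₂`. -/
def S15S02 : Finset (Finset ℕ) :=
  sjoin (genBy {{1, 2}, {2, 3}, {3, 4}, {4, 5}, {1, 5}}) (stdSphere {6, 7})

/-- `Σ₂` (7-vertex 2-sphere with 10 triangles). -/
def Sigma2 : Finset (Finset ℕ) :=
  genBy {{1, 2, 6}, {1, 2, 7}, {1, 6, 7}, {2, 3, 6}, {2, 3, 7},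
         {3, 4, 6}, {3, 4, 7}, {4, 5, 6}, {4, 5, 7}, {5, 6, 7}}

/-- `Σ₃` (7-vertex 2-sphere with 10 triangles). -/
def Sigma3 : Finset (Finset ℕ) :=
  genBy {{1, 2, 6}, {1, 2, 7}, {1, 6, 7}, {2, 3, 4}, {2, 3, 7},
         {2, 4, 6}, {3, 4, 7}, {4, 5, 6}, {4, 5, 7}, {5, 6, 7}}

/-- `Σ₄` (7-vertex 2-sphere with 10 triangles). -/
def Sigma4 : Finset (Finset ℕ) :=
  genBy {{1, 2, 4}, {1, 2, 7}, {1, 4, 5}, {1, 5, 6}, {1, 6, 7},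
         {2, 3, 4}, {2, 3, 7}, {3, 4, 7}, {4, 5, 7}, {5, 6, 7}}

/-- `Σ₅` (7-vertex 2-sphere with 10 triangles). -/
def Sigma5 : Finset (Finset ℕ) :=
  genBy {{1, 2, 3}, {1, 2, 6}, {1, 3, 5}, {1, 5, 6}, {2, 3, 4},
         {2, 4, 6}, {3, 4, 5}, {4, 5, 7}, {4, 6, 7}, {5, 6, 7}}

/-- `Υ₁ = S²₄ ∪ S²₄`: two tetrahedral spheres sharing exactly one vertex. -/
def Upsilon1 : Finset (Finset ℕ) :=
  stdSphere {1, 2, 3, 7} ∪ stdSphere {4, 5, 6, 7}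

/-- `Υ₂ = S²₄ ∪ (S⁰₂ * S¹₃)`: a tetrahedral sphere and a join, where the two
common vertices span an edge of the `S²₄`. -/
def Upsilon2 : Finset (Finset ℕ) :=
  stdSphere {4, 5, 6, 7} ∪ sjoin (stdSphere {6, 7}) (stdSphere {1, 2, 3})

/-- The complex `R` obtained from `ℝP²₆` by the generalized bistellar 1-move
`κ_A`, `A = {1, 2, 5, 6}` (all such choices of `A` yield isomorphic complexes). -/
def Rcomplex : Finset (Finset ℕ) :=
  genBy {{1, 2, 3}, {1, 2, 4}, {1, 2, 5}, {1, 2, 6}, {1, 3, 5},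
         {1, 4, 6}, {2, 3, 6}, {2, 4, 5}, {3, 4, 5}, {3, 4, 6}}


end HomologySpheres

end

namespace FreeFaceSearch

/-- Lists of candidate facets: `cons k b t` is the facet whose column starts at bit `k`
and whose boundary mask is `b`. -/
inductive CL where
  | nil : CL
  | cons (k bd : Nat) (t : CL) : CL

/-- Binary trees of ridges. -/
inductive RT where
  | leaf (p : Nat) (cs : CL) : RT
  | node (m : Nat) (l r : RT) : RT

/-- Evaluates `n` before passing it on. -/
noncomputable def force (n : Nat) (k : Nat → Bool) : Bool :=
  Nat.rec (k 0) (fun m _ => k (Nat.succ m)) n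

noncomputable def pick (ones : Nat) (k : CL → Bool) (t : RT) : Bool :=
  RT.rec (motive := fun _ => Bool)
    (fun p cs => Bool.rec (k cs) false (Nat.beq (Nat.land ones p) 0))
    (fun m _ _ il ir => Bool.rec il ir (Nat.beq (Nat.land ones m) 0)) t

noncomputable def incl (mask B : Nat) (go : Nat → Nat → Nat → Bool) (bd c ones any M : Nat) :
    Bool :=
  force (Nat.lor any bd) fun any' =>
  force (Nat.lor (Nat.xor (Nat.lor ones bd) bd) (Nat.xor any' any)) fun ones' =>
  force (Nat.land c (Nat.sub B c)) fun p =>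
  force (Nat.xor M (Nat.mul c (Nat.lor (Nat.land (Nat.div M p) mask) 2048))) fun M' =>
    go ones' any' M'

noncomputable def cands (mask B : Nat) (go : Nat → Nat → Nat → Bool) (ones any : Nat) (cs : CL) :
    Nat → Bool :=
  CL.rec (motive := fun _ => Nat → Bool) (fun _ => true)
    (fun k bd _ ih M =>
      Nat.rec (motive := fun _ => Bool) (ih M)
        (fun c' _ => Bool.rec false
          (force (Nat.xor M (Nat.mul (Nat.succ c') (Nat.succ (Nat.pow 2 k)))) ih)
          (incl mask B go bd (Nat.succ c') ones any M))
        (Nat.mod (Nat.div M (Nat.pow 2 k)) B)) cs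

noncomputable def search (mask B : Nat) (R : RT) (fuel : Nat) : Nat → Nat → Nat → Bool :=
  Nat.rec (motive := fun _ => Nat → Nat → Nat → Bool) (fun _ _ _ => false)
    (fun _ ih ones any M => pick ones (fun cs => cands mask B ih ones any cs M) R) fuel

noncomputable def startC (mask B : Nat) (go : Nat → Nat → Nat → Bool) (cs : CL) :
    Nat → Nat → Nat → Bool :=
  CL.rec (motive := fun _ => Nat → Nat → Nat → Bool) go
    (fun k bd _ ih ones any M =>
      incl mask B ih bd (Nat.mod (Nat.div M (Nat.pow 2 k)) B) ones any M) cs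

def facetMasks3 : List Nat := [7, 11, 13, 14, 19, 21, 22, 25, 26, 28, 35, 37, 38, 41, 42, 44, 49,
  50, 52, 56, 67, 69, 70, 73, 74, 76, 81, 82, 84, 88, 97, 98, 100, 104, 112]
def ridgeMasks3 : List Nat := [3, 5, 6, 9, 10, 12, 17, 18, 20, 24, 33, 34, 36, 40, 48, 65, 66, 68,
  72, 80, 96]
def bdMasks3 : List Nat := [7, 25, 42, 52, 193, 322, 388, 584, 656, 800, 3073, 5122, 6148, 9224,
  10256, 12320, 17472, 18560, 20736, 25088, 98305, 163842, 196612, 294920, 327696, 393248, 557120,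
  589952, 655616, 786944, 1082368, 1116160, 1183744, 1318912, 1589248]
def ridgeTree3 : RT := (.node 1023 (.node 31 (.node 3 (.node 1 (.leaf 1 (.cons 42 7 (.cons 63 25
  (.cons 126 193 (.cons 252 3073 (.cons 462 98305 .nil)))))) (.leaf 2 (.cons 42 7 (.cons 84 42
  (.cons 147 322 (.cons 273 5122 (.cons 483 163842 .nil))))))) (.node 4 (.leaf 4 (.cons 42 7
  (.cons 105 52 (.cons 168 388 (.cons 294 6148 (.cons 504 196612 .nil)))))) (.node 8 (.leaf 8
  (.cons 63 25 (.cons 84 42 (.cons 189 584 (.cons 315 9224 (.cons 525 294920 .nil)))))) (.leaf 16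
  (.cons 63 25 (.cons 105 52 (.cons 210 656 (.cons 336 10256 (.cons 546 327696 .nil)))))))))
  (.node 96 (.node 32 (.leaf 32 (.cons 84 42 (.cons 105 52 (.cons 231 800 (.cons 357 12320 (.cons
  567 393248 .nil)))))) (.leaf 64 (.cons 126 193 (.cons 147 322 (.cons 189 584 (.cons 378 17472
  (.cons 588 557120 .nil))))))) (.node 128 (.leaf 128 (.cons 126 193 (.cons 168 388 (.cons 210 656
  (.cons 399 18560 (.cons 609 589952 .nil)))))) (.node 256 (.leaf 256 (.cons 147 322 (.cons 168
  388 (.cons 231 800 (.cons 420 20736 (.cons 630 655616 .nil)))))) (.leaf 512 (.cons 189 584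
  (.cons 210 656 (.cons 231 800 (.cons 441 25088 (.cons 651 786944 .nil)))))))))) (.node 31744
  (.node 3072 (.node 1024 (.leaf 1024 (.cons 252 3073 (.cons 273 5122 (.cons 315 9224 (.cons 378
  17472 (.cons 672 1082368 .nil)))))) (.leaf 2048 (.cons 252 3073 (.cons 294 6148 (.cons 336 10256
  (.cons 399 18560 (.cons 693 1116160 .nil))))))) (.node 4096 (.leaf 4096 (.cons 273 5122 (.cons
  294 6148 (.cons 357 12320 (.cons 420 20736 (.cons 714 1183744 .nil)))))) (.node 8192 (.leaf 8192
  (.cons 315 9224 (.cons 336 10256 (.cons 357 12320 (.cons 441 25088 (.cons 735 1318912 .nil))))))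
  (.leaf 16384 (.cons 378 17472 (.cons 399 18560 (.cons 420 20736 (.cons 441 25088 (.cons 756
  1589248 .nil))))))))) (.node 229376 (.node 32768 (.leaf 32768 (.cons 462 98305 (.cons 483 163842
  (.cons 525 294920 (.cons 588 557120 (.cons 672 1082368 .nil)))))) (.node 65536 (.leaf 65536
  (.cons 462 98305 (.cons 504 196612 (.cons 546 327696 (.cons 609 589952 (.cons 693 1116160
  .nil)))))) (.leaf 131072 (.cons 483 163842 (.cons 504 196612 (.cons 567 393248 (.cons 630 655616
  (.cons 714 1183744 .nil)))))))) (.node 262144 (.leaf 262144 (.cons 525 294920 (.cons 546 327696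
  (.cons 567 393248 (.cons 651 786944 (.cons 735 1318912 .nil)))))) (.node 524288 (.leaf 524288
  (.cons 588 557120 (.cons 609 589952 (.cons 630 655616 (.cons 651 786944 (.cons 756 1589248
  .nil)))))) (.leaf 1048576 (.cons 672 1082368 (.cons 693 1116160 (.cons 714 1183744 (.cons 735
  1318912 (.cons 756 1589248 .nil)))))))))))
def startList3 : CL := (.cons 42 7 (.cons 63 25 (.cons 126 193 .nil)))

def colMask3 : Nat :=
  379032918115082306803981925046313454916467932334747791123860248245995680699875672186413732401847552565671102422730222803012205121417954629122783759882376015495632383039025397618834230936817808422252215308856077602641458619219968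

def startMat3 : Nat :=
  602377258188834576085374323664770215396525595256820600232311770681918503096834607944563680448497174994964339261615411915805701076838034924959392682553694201564498680309660849654077781652217600917897750183414587053665397241095628259329

theorem search_true3 :
    startC 379032918115082306803981925046313454916467932334747791123860248245995680699875672186413732401847552565671102422730222803012205121417954629122783759882376015495632383039025397618834230936817808422252215308856077602641458619219968
      2097152
      (search 379032918115082306803981925046313454916467932334747791123860248245995680699875672186413732401847552565671102422730222803012205121417954629122783759882376015495632383039025397618834230936817808422252215308856077602641458619219968
        2097152 ridgeTree3 21)
      startList3 0 0 startMat3 = true := by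
  decide +kernel

def facetMasks4 : List Nat := [15, 23, 27, 29, 30, 39, 43, 45, 46, 51, 53, 54, 57, 58, 60, 71, 75,
  77, 78, 83, 85, 86, 89, 90, 92, 99, 101, 102, 105, 106, 108, 113, 114, 116, 120]
def ridgeMasks4 : List Nat := [7, 11, 13, 14, 19, 21, 22, 25, 26, 28, 35, 37, 38, 41, 42, 44, 49,
  50, 52, 56, 67, 69, 70, 73, 74, 76, 81, 82, 84, 88, 97, 98, 100, 104, 112]
def bdMasks4 : List Nat := [15, 113, 402, 676, 840, 7169, 25602, 43012, 53256, 197648, 329760,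
  397376, 598144, 672000, 819712, 7340033, 26214402, 44040196, 54525960, 202375184, 337641504,
  406847552, 612368512, 687866112, 838861312, 3222275072, 5370808320, 6446649344, 9672073216,
  10754211840, 12918489088, 18320785408, 19461701632, 21743534080, 26307198976]
def ridgeTree4 : RT := (.node 131071 (.node 255 (.node 15 (.node 3 (.node 1 (.leaf 1 (.cons 70 15
  (.cons 105 113 (.cons 245 7169 (.cons 595 7340033 .nil))))) (.leaf 2 (.cons 70 15 (.cons 140 402
  (.cons 280 25602 (.cons 630 26214402 .nil)))))) (.node 4 (.leaf 4 (.cons 70 15 (.cons 175 676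
  (.cons 315 43012 (.cons 665 44040196 .nil))))) (.leaf 8 (.cons 70 15 (.cons 210 840 (.cons 350
  53256 (.cons 700 54525960 .nil))))))) (.node 48 (.node 16 (.leaf 16 (.cons 105 113 (.cons 140
  402 (.cons 385 197648 (.cons 735 202375184 .nil))))) (.leaf 32 (.cons 105 113 (.cons 175 676
  (.cons 420 329760 (.cons 770 337641504 .nil)))))) (.node 64 (.leaf 64 (.cons 105 113 (.cons 210
  840 (.cons 455 397376 (.cons 805 406847552 .nil))))) (.leaf 128 (.cons 140 402 (.cons 175 676
  (.cons 490 598144 (.cons 840 612368512 .nil)))))))) (.node 3840 (.node 768 (.node 256 (.leaf 256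
  (.cons 140 402 (.cons 210 840 (.cons 525 672000 (.cons 875 687866112 .nil))))) (.leaf 512 (.cons
  175 676 (.cons 210 840 (.cons 560 819712 (.cons 910 838861312 .nil)))))) (.node 1024 (.leaf 1024
  (.cons 245 7169 (.cons 280 25602 (.cons 385 197648 (.cons 945 3222275072 .nil))))) (.leaf 2048
  (.cons 245 7169 (.cons 315 43012 (.cons 420 329760 (.cons 980 5370808320 .nil))))))) (.node
  12288 (.node 4096 (.leaf 4096 (.cons 245 7169 (.cons 350 53256 (.cons 455 397376 (.cons 1015
  6446649344 .nil))))) (.leaf 8192 (.cons 280 25602 (.cons 315 43012 (.cons 490 598144 (.cons 1050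
  9672073216 .nil)))))) (.node 16384 (.leaf 16384 (.cons 280 25602 (.cons 350 53256 (.cons 525
  672000 (.cons 1085 10754211840 .nil))))) (.node 32768 (.leaf 32768 (.cons 315 43012 (.cons 350
  53256 (.cons 560 819712 (.cons 1120 12918489088 .nil))))) (.leaf 65536 (.cons 385 197648 (.cons
  420 329760 (.cons 490 598144 (.cons 1155 18320785408 .nil)))))))))) (.node 66977792 (.node
  1966080 (.node 393216 (.node 131072 (.leaf 131072 (.cons 385 197648 (.cons 455 397376 (.cons 525
  672000 (.cons 1190 19461701632 .nil))))) (.leaf 262144 (.cons 420 329760 (.cons 455 397376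
  (.cons 560 819712 (.cons 1225 21743534080 .nil)))))) (.node 524288 (.leaf 524288 (.cons 490
  598144 (.cons 525 672000 (.cons 560 819712 (.cons 1260 26307198976 .nil))))) (.leaf 1048576
  (.cons 595 7340033 (.cons 630 26214402 (.cons 735 202375184 (.cons 945 3222275072 .nil)))))))
  (.node 6291456 (.node 2097152 (.leaf 2097152 (.cons 595 7340033 (.cons 665 44040196 (.cons 770
  337641504 (.cons 980 5370808320 .nil))))) (.leaf 4194304 (.cons 595 7340033 (.cons 700 54525960
  (.cons 805 406847552 (.cons 1015 6446649344 .nil)))))) (.node 8388608 (.leaf 8388608 (.cons 630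
  26214402 (.cons 665 44040196 (.cons 840 612368512 (.cons 1050 9672073216 .nil))))) (.node
  16777216 (.leaf 16777216 (.cons 630 26214402 (.cons 700 54525960 (.cons 875 687866112 (.cons
  1085 10754211840 .nil))))) (.leaf 33554432 (.cons 665 44040196 (.cons 700 54525960 (.cons 910
  838861312 (.cons 1120 12918489088 .nil))))))))) (.node 1006632960 (.node 201326592 (.node
  67108864 (.leaf 67108864 (.cons 735 202375184 (.cons 770 337641504 (.cons 840 612368512 (.cons
  1155 18320785408 .nil))))) (.leaf 134217728 (.cons 735 202375184 (.cons 805 406847552 (.cons 875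
  687866112 (.cons 1190 19461701632 .nil)))))) (.node 268435456 (.leaf 268435456 (.cons 770
  337641504 (.cons 805 406847552 (.cons 910 838861312 (.cons 1225 21743534080 .nil))))) (.leaf
  536870912 (.cons 840 612368512 (.cons 875 687866112 (.cons 910 838861312 (.cons 1260 26307198976
  .nil))))))) (.node 3221225472 (.node 1073741824 (.leaf 1073741824 (.cons 945 3222275072 (.cons
  980 5370808320 (.cons 1050 9672073216 (.cons 1155 18320785408 .nil))))) (.leaf 2147483648 (.cons
  945 3222275072 (.cons 1015 6446649344 (.cons 1085 10754211840 (.cons 1190 19461701632 .nil))))))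
  (.node 4294967296 (.leaf 4294967296 (.cons 980 5370808320 (.cons 1015 6446649344 (.cons 1120
  12918489088 (.cons 1225 21743534080 .nil))))) (.node 8589934592 (.leaf 8589934592 (.cons 1050
  9672073216 (.cons 1085 10754211840 (.cons 1120 12918489088 (.cons 1260 26307198976 .nil)))))
  (.leaf 17179869184 (.cons 1155 18320785408 (.cons 1190 19461701632 (.cons 1225 21743534080
  (.cons 1260 26307198976 .nil)))))))))))
def startList4 : CL := (.cons 70 15 (.cons 105 113 (.cons 245 7169 .nil)))

def colMask4 : Nat :=
  19851555242476100494256494874960894368520551390404327467310873164776763033690225086297733625969480822206312549367840188671367754761638770315956082475186121184209532590802452677493967252111630130556513867212049469083477926167694823734722720530852342112042928308358973717766716233285216019159733742765470767062359191982755914155523775330078989288031325299731166743003155048045740032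

def startMat4 : Nat :=
  522238813744238016490950826171462956819900326867301276275166011075017060418287196333160768711532155065534642152694238594000206101252971968756537572345698960374530456743958233322054365871115102795736283831061124887391387282972269494088540960520454143635126621364745432563883515955032191279577274391878548636745323277908048311585372043820243039462296538489361358425286017796040940767345115137

theorem search_true4 :
    startC 19851555242476100494256494874960894368520551390404327467310873164776763033690225086297733625969480822206312549367840188671367754761638770315956082475186121184209532590802452677493967252111630130556513867212049469083477926167694823734722720530852342112042928308358973717766716233285216019159733742765470767062359191982755914155523775330078989288031325299731166743003155048045740032
      34359738368
      (search 19851555242476100494256494874960894368520551390404327467310873164776763033690225086297733625969480822206312549367840188671367754761638770315956082475186121184209532590802452677493967252111630130556513867212049469083477926167694823734722720530852342112042928308358973717766716233285216019159733742765470767062359191982755914155523775330078989288031325299731166743003155048045740032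
        34359738368 ridgeTree4 21)
      startList4 0 0 startMat4 = true := by
  decide +kernel


theorem force_eq (n : Nat) (k : Nat → Bool) : force n k = k n := by
  cases n <;> rfl

/-- The bits of a number as a vector over the two-element field. -/
def toVec (n : ℕ) : ℕ → ZMod 2 := fun j => if n.testBit j = true then 1 else 0

theorem toVec_zero : toVec 0 = 0 := by
  funext j; simp [toVec]

theorem toVec_xor (a b : ℕ) : toVec (a ^^^ b) = toVec a + toVec b := by
  funext j
  simp only [toVec, Nat.testBit_xor, Pi.add_apply]
  cases a.testBit j <;> cases b.testBit j <;> simp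
  decide

theorem vec_add_self (a : ℕ → ZMod 2) : a + a = 0 := by
  funext j
  exact CharTwo.add_self_eq_zero (a j)

/-- The column number `x`. -/
def fld (w M x : ℕ) : ℕ := M / 2 ^ (w * (x + 2)) % 2 ^ w

theorem fld_xor (w a b x : ℕ) : fld w (a ^^^ b) x = fld w a x ^^^ fld w b x := by
  simp only [fld, Nat.xor_div_two_pow, Nat.xor_mod_two_pow]

theorem fld_lt (w M x : ℕ) : fld w M x < 2 ^ w := Nat.mod_lt _ (by positivity)

/-- Multiplying by a number all of whose digits are `0` or `1`. -/
theorem mul_digits (w c N n : ℕ) (hc : c < 2 ^ w) (h0 : c * (N % 2 ^ (w * 2)) < 2 ^ (w * 2))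
    (hd : ∀ x < n, fld w N x ≤ 1) : ∀ x ≤ n, c * (N % 2 ^ (w * (x + 2))) < 2 ^ (w * (x + 2)) := by
  intro x
  induction x with
  | zero => intro _; simpa using h0
  | succ x ih =>
    intro hx
    have h1 := ih (by omega)
    have h2 := hd x (by omega)
    have e : 2 ^ (w * (x + 1 + 2)) = 2 ^ (w * (x + 2)) * 2 ^ w := by
      rw [← pow_add]; congr 1
    have e2 : N % 2 ^ (w * (x + 1 + 2)) = N % 2 ^ (w * (x + 2)) + 2 ^ (w * (x + 2)) * fld w N x := by
      rw [e, Nat.mod_mul]; rfl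
    rw [e2, e]
    have h3 : c * fld w N x ≤ c := by nlinarith
    have h4 : c + 1 ≤ 2 ^ w := hc
    calc c * (N % 2 ^ (w * (x + 2)) + 2 ^ (w * (x + 2)) * fld w N x)
        = c * (N % 2 ^ (w * (x + 2))) + 2 ^ (w * (x + 2)) * (c * fld w N x) := by ring
      _ < 2 ^ (w * (x + 2)) + 2 ^ (w * (x + 2)) * c := by
          have := Nat.mul_le_mul_left (2 ^ (w * (x + 2))) h3
          omega
      _ = 2 ^ (w * (x + 2)) * (c + 1) := by ring
      _ ≤ _ := Nat.mul_le_mul_left _ h4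

theorem fld_mul (w c N n : ℕ) (hc : c < 2 ^ w) (h0 : c * (N % 2 ^ (w * 2)) < 2 ^ (w * 2))
    (hd : ∀ x < n, fld w N x ≤ 1) (x : ℕ) (hx : x < n) : fld w (c * N) x = c * fld w N x := by
  have h1 := mul_digits w c N n hc h0 hd x hx.le
  have h2 := hd x hx
  have e : c * N = c * (N % 2 ^ (w * (x + 2))) + 2 ^ (w * (x + 2)) * (c * (N / 2 ^ (w * (x + 2)))) := by
    conv_lhs => rw [← Nat.mod_add_div N (2 ^ (w * (x + 2)))]
    ring
  have e3 : c * N / 2 ^ (w * (x + 2)) = c * (N / 2 ^ (w * (x + 2))) := by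
    rw [e, Nat.add_mul_div_left _ _ (by positivity), Nat.div_eq_of_lt h1, zero_add]
  have h3 : c * fld w N x ≤ c := by nlinarith
  unfold fld at *
  rw [e3, Nat.mul_mod, Nat.mod_eq_of_lt hc, Nat.mod_eq_of_lt]
  omega

theorem fld_one_add_pow (w x y : ℕ) (hw : 0 < w) :
    fld w (2 ^ (w * (y + 2)) + 1) x = if x = y then 1 else 0 := by
  have hB : 1 < 2 ^ w := Nat.one_lt_two_pow hw.ne'
  unfold fld
  rcases lt_trichotomy x y with h | h | h
  · rw [if_neg h.ne]
    obtain ⟨d, rfl⟩ := Nat.exists_eq_add_of_lt h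
    have e : 2 ^ (w * (x + d + 1 + 2)) = 2 ^ (w * (x + 2)) * (2 ^ w * 2 ^ (w * d)) := by
      rw [← pow_add, ← pow_add]; congr 1; ring
    rw [e, add_comm, Nat.add_mul_div_left _ _ (by positivity), Nat.div_eq_of_lt, zero_add,
      Nat.mul_mod_right]
    exact Nat.one_lt_two_pow (by positivity)
  · subst h
    rw [if_pos rfl]
    have : 1 < 2 ^ (w * (x + 2)) := Nat.one_lt_two_pow (by positivity)
    rw [add_comm, Nat.add_div_right _ (by positivity), Nat.div_eq_of_lt this]
    exact Nat.mod_eq_of_lt hB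
  · rw [if_neg h.ne']
    obtain ⟨d, rfl⟩ := Nat.exists_eq_add_of_lt h
    rw [Nat.div_eq_of_lt, Nat.zero_mod]
    have e : 2 ^ (w * (y + d + 1 + 2)) = 2 ^ (w * (y + 2)) * (2 ^ (w * (d + 1))) := by
      rw [← pow_add]; congr 1; ring
    have : 1 < 2 ^ (w * (y + 2)) := Nat.one_lt_two_pow (by positivity)
    have h2 : 1 < 2 ^ (w * (d + 1)) := Nat.one_lt_two_pow (by positivity)
    rw [e]
    nlinarith

/-- The column effect of an exclusion. -/
theorem fld_exclude (w M c x y : ℕ) (hw : 0 < w) (hc : c < 2 ^ w) (hxy : x ≠ y) :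
    fld w (M ^^^ (c * (2 ^ (w * (y + 2)) + 1))) x = fld w M x := by
  have hB : 1 < 2 ^ w := Nat.one_lt_two_pow hw.ne'
  rw [fld_xor, fld_mul w c _ (x + 1) hc _ _ x (by omega), fld_one_add_pow w x y hw, if_neg hxy]
  · simp
  · have e : 2 ^ (w * (y + 2)) = 2 ^ (w * 2) * 2 ^ (w * y) := by
      rw [← pow_add]; congr 1; ring
    have e2 : 2 ^ (w * 2) = 2 ^ w * 2 ^ w := by rw [← pow_add]; congr 1; ring
    rw [e, add_comm, Nat.add_mul_mod_self_left, Nat.mod_eq_of_lt (by rw [e2]; nlinarith), e2]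
    nlinarith
  · intro z _
    rw [fld_one_add_pow w z y hw]; split <;> omega

/-- The column effect of an inclusion. -/
theorem fld_incl (w M A c x mask : ℕ) (hw : 12 ≤ w) (hc : c < 2 ^ w)
    (hm0 : mask % 2 ^ (w * 2) = 0) (hm : ∀ x < 35, fld w mask x = 1) (hx : x < 35) :
    fld w (M ^^^ (c * ((A &&& mask) ||| 2048))) x = fld w M x ∨
    fld w (M ^^^ (c * ((A &&& mask) ||| 2048))) x = fld w M x ^^^ c := by
  have hB : 2 ^ 12 ≤ 2 ^ w := Nat.pow_le_pow_right (by norm_num) hw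
  have e2 : 2 ^ (w * 2) = 2 ^ w * 2 ^ w := by rw [← pow_add]; congr 1; ring
  have key : ∀ z < 35, fld w ((A &&& mask) ||| 2048) z = fld w A z % 2 := by
    intro z hz
    have h1 : 2048 / 2 ^ (w * (z + 2)) = 0 := by
      apply Nat.div_eq_of_lt
      calc 2048 < 2 ^ 12 := by norm_num
        _ ≤ 2 ^ (w * (z + 2)) := Nat.pow_le_pow_right (by norm_num) (by nlinarith)
    have h2 := hm z hz
    unfold fld at h2 ⊢
    rw [Nat.or_div_two_pow, h1, Nat.or_zero, Nat.and_div_two_pow, Nat.and_mod_two_pow, h2,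
      Nat.and_one_is_mod]
  rw [fld_xor, fld_mul w c _ 35 hc _ _ x hx, key x hx]
  · rcases Nat.mod_two_eq_zero_or_one (fld w A x) with h | h
    · left; simp [h]
    · right; simp [h]
  · have h1 : 2048 % 2 ^ (w * 2) = 2048 := Nat.mod_eq_of_lt (by rw [e2]; nlinarith)
    rw [Nat.or_mod_two_pow, h1, Nat.and_mod_two_pow, hm0, Nat.and_zero, Nat.zero_or, e2]
    nlinarith
  · intro z hz
    rw [key z hz]; omega

/-- The search invariant. -/
structure Inv (w : ℕ) (bdv : ℕ → ℕ) (T I : Finset ℕ) (ones any M : ℕ) : Prop where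
  sub : I ⊆ T
  hany : ∀ j, any.testBit j = true ↔ ∃ x ∈ I, (bdv x).testBit j = true
  hones : ∀ j, ones.testBit j = true →
    ∃ x ∈ I, (bdv x).testBit j = true ∧ ∀ y ∈ I, (bdv y).testBit j = true → y = x
  hcol : ∀ x ∈ T, x ∉ I →
    toVec (fld w M x) + toVec (bdv x) ∈
      Submodule.span (ZMod 2) ((fun y => toVec (bdv y)) '' (I : Set ℕ))

theorem incl_sound (w mask : ℕ) (bdv : ℕ → ℕ) (T I : Finset ℕ) (ones any M : ℕ)
    (hw : 12 ≤ w) (hT : ∀ x ∈ T, x < 35)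
    (hm0 : mask % 2 ^ (w * 2) = 0) (hm : ∀ x < 35, fld w mask x = 1)
    (go : ℕ → ℕ → ℕ → Bool)
    (hinv : Inv w bdv T I ones any M) (x : ℕ) (hx : x ∈ T) (hxI : x ∉ I)
    (hgo : ∀ ones any M, Inv w bdv T (insert x I) ones any M → go ones any M = true → False)
    (h : incl mask (2 ^ w) go (bdv x) (fld w M x) ones any M = true) : False := by
  unfold incl at h
  simp only [force_eq] at h
  refine hgo _ _ _ ?_ h
  refine ⟨Finset.insert_subset hx hinv.sub, ?_, ?_, ?_⟩
  · intro j
    have := hinv.hany j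
    change (any ||| bdv x).testBit j = true ↔ _
    rw [Nat.testBit_or, Bool.or_eq_true, this]
    simp only [Finset.mem_insert, exists_eq_or_imp]
    exact or_comm
  · intro j hj
    have ha := hinv.hany j
    change ((((ones ||| bdv x) ^^^ bdv x)) ||| ((any ||| bdv x) ^^^ any)).testBit j = true at hj
    simp only [Nat.testBit_or, Nat.testBit_xor] at hj
    by_cases hb : (bdv x).testBit j = true
    · have hany : any.testBit j = false := by
        by_contra hcon
        rw [hb] at hj
        simp at hcon
        rw [hcon] at hj
        simp at hj
      refine ⟨x, Finset.mem_insert_self _ _, hb, ?_⟩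
      intro y hy hyj
      rcases Finset.mem_insert.1 hy with rfl | hy
      · rfl
      · have := ha.2 ⟨y, hy, hyj⟩
        rw [hany] at this
        exact absurd this (by simp)
    · simp at hb
      rw [hb] at hj
      simp at hj
      obtain ⟨x0, hx0, hx0j, hu⟩ := hinv.hones j hj
      refine ⟨x0, Finset.mem_insert_of_mem hx0, hx0j, ?_⟩
      intro y hy hyj
      rcases Finset.mem_insert.1 hy with rfl | hy
      · rw [hb] at hyj
        exact absurd hyj (by simp)
      · exact hu y hy hyj
  · intro y hy hyI
    simp only [Finset.mem_insert, not_or] at hyI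
    have hmono : Submodule.span (ZMod 2) ((fun y => toVec (bdv y)) '' (I : Set ℕ)) ≤
        Submodule.span (ZMod 2) ((fun y => toVec (bdv y)) '' ((insert x I : Finset ℕ) : Set ℕ)) :=
      Submodule.span_mono (Set.image_mono (by simp))
    have h1 := hmono (hinv.hcol y hy hyI.2)
    have h2 := hmono (hinv.hcol x hx hxI)
    have h3 : toVec (bdv x) ∈ Submodule.span (ZMod 2)
        ((fun y => toVec (bdv y)) '' ((insert x I : Finset ℕ) : Set ℕ)) :=
      Submodule.subset_span ⟨x, by simp, rfl⟩
    have h4 := Submodule.add_mem _ h2 h3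
    rw [add_assoc, vec_add_self, add_zero] at h4
    rcases fld_incl w M (M / (fld w M x &&& (2 ^ w - fld w M x))) (fld w M x) y mask hw
      (fld_lt _ _ _) hm0 hm (hT y hy) with h5 | h5
    · have : toVec (fld w (M ^^^ (fld w M x * ((M / (fld w M x &&& (2 ^ w - fld w M x)) &&& mask)
        ||| 2048))) y) + toVec (bdv y) ∈ Submodule.span (ZMod 2)
        ((fun y => toVec (bdv y)) '' ((insert x I : Finset ℕ) : Set ℕ)) := by
        rw [h5]; exact h1
      exact this
    · have : toVec (fld w (M ^^^ (fld w M x * ((M / (fld w M x &&& (2 ^ w - fld w M x)) &&& mask)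
        ||| 2048))) y) + toVec (bdv y) ∈ Submodule.span (ZMod 2)
        ((fun y => toVec (bdv y)) '' ((insert x I : Finset ℕ) : Set ℕ)) := by
        rw [h5, toVec_xor, add_right_comm]; exact Submodule.add_mem _ h1 h4
      exact this

/-- All entries of the list are facets. -/
def clOK (w : ℕ) (bdv : ℕ → ℕ) : CL → Bool
  | .nil => true
  | .cons k b t => (List.range 35).any (fun y => k == w * (y + 2) && b == bdv y) && clOK w bdv t

/-- The facet `y` occurs in the list. -/
def clHas (w y : ℕ) : CL → Bool
  | .nil => false
  | .cons k _ t => k == w * (y + 2) || clHas w y t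

def rtOK (w : ℕ) (bdv : ℕ → ℕ) : RT → Bool
  | .leaf p cs => (List.range w).any (fun j => p == 2 ^ j &&
      (List.range 35).all (fun y => !(bdv y).testBit j || clHas w y cs)) && clOK w bdv cs
  | .node _ l r => rtOK w bdv l && rtOK w bdv r

theorem cands_sound (w mask : ℕ) (bdv : ℕ → ℕ) (T I : Finset ℕ) (ones any : ℕ)
    (hw : 12 ≤ w) (hT : ∀ x ∈ T, x < 35)
    (hm0 : mask % 2 ^ (w * 2) = 0) (hm : ∀ x < 35, fld w mask x = 1)
    (hind : ∀ I : Finset ℕ, I ⊆ T → ∀ x ∈ T, x ∉ I → toVec (bdv x) ∉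
      Submodule.span (ZMod 2) ((fun y => toVec (bdv y)) '' (I : Set ℕ)))
    (go : ℕ → ℕ → ℕ → Bool)
    (hgo : ∀ ones any M, ∀ I, Inv w bdv T I ones any M →
      go ones any M = true → False)
    (cs : CL) : ∀ M, Inv w bdv T I ones any M → clOK w bdv cs = true →
      (∃ x ∈ T, x ∉ I ∧ clHas w x cs = true) →
      cands mask (2 ^ w) go ones any cs M = true → False := by
  induction cs with
  | nil => rintro M _ _ ⟨x, _, _, hx⟩; simp [clHas] at hx
  | cons k b t ih =>
    intro M hinv hok hex h
    simp only [clOK, Bool.and_eq_true, List.any_eq_true, beq_iff_eq] at hok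
    obtain ⟨⟨y, hy, rfl, rfl⟩, hok⟩ := hok
    have h' : Nat.rec (motive := fun _ => Bool) (cands mask (2 ^ w) go ones any t M)
        (fun c' _ => Bool.rec false
          (force (Nat.xor M (Nat.mul (Nat.succ c') (Nat.succ (Nat.pow 2 (w * (y + 2))))))
            (cands mask (2 ^ w) go ones any t))
          (incl mask (2 ^ w) go (bdv y) (Nat.succ c') ones any M))
        (fld w M y) = true := h
    clear h
    by_cases hyT : y ∈ T ∧ y ∉ I
    · rcases hc : fld w M y with _ | c
      · have := hinv.hcol y hyT.1 hyT.2
        rw [hc, toVec_zero, zero_add] at this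
        exact hind I hinv.sub y hyT.1 hyT.2 this
      · rw [hc] at h'
        have h2 := incl_sound w mask bdv T I ones any M hw hT hm0 hm go hinv y hyT.1 hyT.2
          (fun o a M' hi => hgo o a M' _ hi)
        rw [hc] at h2
        simp only at h'
        cases hi : incl mask (2 ^ w) go (bdv y) (Nat.succ c) ones any M with
        | true => exact h2 hi
        | false => rw [hi] at h'; exact absurd h' (by simp)
    · have hex' : ∃ x ∈ T, x ∉ I ∧ clHas w x t = true := by
        obtain ⟨x, hxT, hxI, hx⟩ := hex
        refine ⟨x, hxT, hxI, ?_⟩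
        simp only [clHas, Bool.or_eq_true, beq_iff_eq] at hx
        rcases hx with hx | hx
        · have : y + 2 = x + 2 := Nat.eq_of_mul_eq_mul_left (by omega) hx
          have : y = x := by omega
          subst this
          exact absurd ⟨hxT, hxI⟩ hyT
        · exact hx
      rcases hc : fld w M y with _ | c
      · rw [hc] at h'
        exact ih M hinv hok hex' h'
      · rw [hc] at h'
        simp only [force_eq] at h'
        have hlt := fld_lt w M y
        rw [hc] at hlt
        cases hi : incl mask (2 ^ w) go (bdv y) (Nat.succ c) ones any M with
        | true =>
          rw [hi] at h'
          refine ih _ ⟨hinv.sub, hinv.hany, hinv.hones, ?_⟩ hok hex' h'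
          intro x hx hxI
          have hne : x ≠ y := by rintro rfl; exact hyT ⟨hx, hxI⟩
          have e := fld_exclude w M (c + 1) x y (by omega) hlt hne
          have := hinv.hcol x hx hxI
          rw [← e] at this
          exact this
        | false => rw [hi] at h'; exact absurd h' (by simp)

theorem pick_sound (w : ℕ) (bdv : ℕ → ℕ) (ones : ℕ) (k : CL → Bool) (t : RT)
    (hk : ∀ cs j, ones.testBit j = true → clOK w bdv cs = true →
      (∀ y < 35, (bdv y).testBit j = true → clHas w y cs = true) → k cs = true → False)
    (hok : rtOK w bdv t = true) (h : pick ones k t = true) : False := by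
  induction t with
  | leaf p cs =>
    simp only [rtOK, Bool.and_eq_true, List.any_eq_true, beq_iff_eq, List.all_eq_true,
      List.mem_range, Bool.or_eq_true, Bool.not_eq_true'] at hok
    obtain ⟨⟨j, _, rfl, hall⟩, hcl⟩ := hok
    have h' : Bool.rec (motive := fun _ => Bool) (k cs) false
      (Nat.beq (ones &&& 2 ^ j) 0) = true := h
    cases hb : Nat.beq (ones &&& 2 ^ j) 0 with
    | true => rw [hb] at h'; exact absurd h' (by simp)
    | false =>
      rw [hb] at h'
      refine hk cs j ?_ hcl ?_ h'
      · rw [Nat.and_two_pow] at hb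
        cases hj : ones.testBit j with
        | true => rfl
        | false => rw [hj] at hb; simp at hb
      · intro y hy hyj
        rcases hall y hy with h | h
        · rw [hyj] at h; exact absurd h (by simp)
        · exact h
  | node m l r ihl ihr =>
    simp only [rtOK, Bool.and_eq_true] at hok
    have h' : Bool.rec (motive := fun _ => Bool) (pick ones k l) (pick ones k r)
      (Nat.beq (ones &&& m) 0) = true := h
    cases hb : Nat.beq (ones &&& m) 0 with
    | true => rw [hb] at h'; exact ihr hok.2 h'
    | false => rw [hb] at h'; exact ihl hok.1 h'

theorem search_sound (w mask : ℕ) (bdv : ℕ → ℕ) (T : Finset ℕ) (R : RT)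
    (hw : 12 ≤ w) (hT : ∀ x ∈ T, x < 35)
    (hm0 : mask % 2 ^ (w * 2) = 0) (hm : ∀ x < 35, fld w mask x = 1)
    (hR : rtOK w bdv R = true)
    (hind : ∀ I : Finset ℕ, I ⊆ T → ∀ x ∈ T, x ∉ I → toVec (bdv x) ∉
      Submodule.span (ZMod 2) ((fun y => toVec (bdv y)) '' (I : Set ℕ)))
    (hdeg : ∀ x ∈ T, ∀ j, (bdv x).testBit j = true →
      ∃ y ∈ T, y ≠ x ∧ (bdv y).testBit j = true)
    (fuel : ℕ) : ∀ ones any M, ∀ I, Inv w bdv T I ones any M →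
      search mask (2 ^ w) R fuel ones any M = true → False := by
  induction fuel with
  | zero => intro ones any M I _ h; exact absurd h (by simp [search])
  | succ f ih =>
    intro ones any M I hinv h
    have h' : pick ones (fun cs => cands mask (2 ^ w) (search mask (2 ^ w) R f) ones any cs M) R
      = true := h
    refine pick_sound w bdv ones _ R ?_ hR h'
    intro cs j hj hcl hcs hc
    refine cands_sound w mask bdv T I ones any hw hT hm0 hm hind _ ih cs M hinv hcl ?_ hc
    obtain ⟨x, hx, hxj, hu⟩ := hinv.hones j hj
    obtain ⟨y, hy, hyx, hyj⟩ := hdeg x (hinv.sub hx) j hxj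
    exact ⟨y, hy, fun hyI => hyx (hu y hyI hyj), hcs y (hT y hy) hyj⟩

/-- Soundness of the whole computation, started at three facets. -/
theorem start_sound (w mask M fuel : ℕ) (bdv : ℕ → ℕ) (T : Finset ℕ) (R : RT)
    (hw : 12 ≤ w) (hT : ∀ x ∈ T, x < 35)
    (hm0 : mask % 2 ^ (w * 2) = 0) (hm : ∀ x < 35, fld w mask x = 1)
    (hM : ∀ x < 35, fld w M x = bdv x)
    (hR : rtOK w bdv R = true)
    (hind : ∀ I : Finset ℕ, I ⊆ T → ∀ x ∈ T, x ∉ I → toVec (bdv x) ∉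
      Submodule.span (ZMod 2) ((fun y => toVec (bdv y)) '' (I : Set ℕ)))
    (hdeg : ∀ x ∈ T, ∀ j, (bdv x).testBit j = true →
      ∃ y ∈ T, y ≠ x ∧ (bdv y).testBit j = true)
    (x0 x1 x2 : ℕ) (h0 : x0 ∈ T) (h1 : x1 ∈ T) (h2 : x2 ∈ T)
    (h01 : x0 ≠ x1) (h02 : x0 ≠ x2) (h12 : x1 ≠ x2)
    (h : startC mask (2 ^ w) (search mask (2 ^ w) R fuel)
      (.cons (w * (x0 + 2)) (bdv x0) (.cons (w * (x1 + 2)) (bdv x1)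
        (.cons (w * (x2 + 2)) (bdv x2) .nil))) 0 0 M = true) : False := by
  have hs := search_sound w mask bdv T R hw hT hm0 hm hR hind hdeg fuel
  have inv0 : Inv w bdv T ∅ 0 0 M := by
    refine ⟨by simp, by simp, by simp, ?_⟩
    intro x hx _
    rw [hM x (hT x hx), vec_add_self]
    exact Submodule.zero_mem _
  have hs2 : ∀ ones any M, Inv w bdv T {x0, x1} ones any M →
      incl mask (2 ^ w) (search mask (2 ^ w) R fuel) (bdv x2) (fld w M x2) ones any M = true →
      False := by
    intro ones any M hinv h
    exact incl_sound w mask bdv T {x0, x1} ones any M hw hT hm0 hm _ hinv x2 h2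
      (by simp [h02.symm, h12.symm]) (fun o a M' hi => hs o a M' _ hi) h
  have hs1 : ∀ ones any M, Inv w bdv T {x0} ones any M →
      incl mask (2 ^ w) (fun ones any M => incl mask (2 ^ w) (search mask (2 ^ w) R fuel) (bdv x2)
        (fld w M x2) ones any M) (bdv x1) (fld w M x1) ones any M = true →
      False := by
    intro ones any M hinv h
    refine incl_sound w mask bdv T {x0} ones any M hw hT hm0 hm _ hinv x1 h1
      (by simp [h01.symm]) (fun o a M' hi => hs2 o a M' ?_) h
    rwa [Finset.pair_comm]
  exact incl_sound w mask bdv T ∅ 0 0 M hw hT hm0 hm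
    (fun ones any M => incl mask (2 ^ w) (fun ones any M => incl mask (2 ^ w)
      (search mask (2 ^ w) R fuel) (bdv x2) (fld w M x2) ones any M) (bdv x1) (fld w M x1)
      ones any M) inv0 x0 h0
    (by simp) (fun o a M' hi => hs1 o a M' hi) h

/-- The subset of `Fin 7` encoded by a mask. -/
def maskSet (m : ℕ) : Finset (Fin 7) := Finset.univ.filter fun i => m.testBit i = true

theorem mem_span_image (f : ℕ → ℕ → ZMod 2) (I : Finset ℕ) (v : ℕ → ZMod 2)
    (h : v ∈ Submodule.span (ZMod 2) (f '' (I : Set ℕ))) :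
    ∃ S ⊆ I, v = ∑ s ∈ S, f s := by
  induction h using Submodule.span_induction with
  | mem x hx =>
    obtain ⟨y, hy, rfl⟩ := hx
    exact ⟨{y}, by simpa using hy, by simp⟩
  | zero => exact ⟨∅, by simp, by simp⟩
  | add x y _ _ hx hy =>
    obtain ⟨S, hS, rfl⟩ := hx
    obtain ⟨S', hS', rfl⟩ := hy
    refine ⟨symmDiff S S', ?_, ?_⟩
    · intro a ha
      rcases Finset.mem_symmDiff.1 ha with h | h
      · exact hS h.1
      · exact hS' h.1
    · have e1 : ∑ s ∈ S, f s = ∑ s ∈ S \ S', f s + ∑ s ∈ S ∩ S', f s := by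
        rw [add_comm]; exact (Finset.sum_inter_add_sum_sdiff S S' f).symm
      have e2 : ∑ s ∈ S', f s = ∑ s ∈ S' \ S, f s + ∑ s ∈ S ∩ S', f s := by
        rw [add_comm, Finset.inter_comm]; exact (Finset.sum_inter_add_sum_sdiff S' S f).symm
      have e3 : ∑ s ∈ symmDiff S S', f s = ∑ s ∈ S \ S', f s + ∑ s ∈ S' \ S, f s := by
        rw [symmDiff_def]
        exact Finset.sum_union (Finset.disjoint_left.2 fun a ha hb => by
          simp only [Finset.mem_sdiff] at ha hb; exact ha.2 hb.1)
      rw [e1, e2, e3, add_add_add_comm, vec_add_self, add_zero]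
  | smul a x _ hx =>
    obtain ⟨S, hS, rfl⟩ := hx
    have : a = 0 ∨ a = 1 := by revert a; decide
    rcases this with rfl | rfl
    · exact ⟨∅, by simp, by simp⟩
    · exact ⟨S, hS, by simp⟩

theorem core_aux {V : Type*} [DecidableEq V] (k w mask M fuel : ℕ) (FM RM BM : List ℕ) (R : RT)
    (hw : 12 ≤ w) (hm0 : mask % 2 ^ (w * 2) = 0) (hm : ∀ x < 35, fld w mask x = 1)
    (hM : ∀ x < 35, fld w M x = BM.getD x 0) (hR : rtOK w (fun x => BM.getD x 0) R = true)
    (hBlt : ∀ x < 35, BM.getD x 0 < 2 ^ w)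
    (hbd : ∀ x < 35, ∀ j < w, ((BM.getD x 0).testBit j = true ↔
      maskSet (RM.getD j 0) ⊆ maskSet (FM.getD x 0)))
    (hF : ∀ s : Finset (Fin 7), s.card = k → ∃ y < 35, maskSet (FM.getD y 0) = s)
    (hFi : ∀ x < 35, ∀ y < 35, FM.getD x 0 = FM.getD y 0 → x = y)
    (hFl : ∀ x < 35, FM.getD x 0 < 2 ^ 7)
    (hRk : ∀ j < w, (maskSet (RM.getD j 0)).card = k - 1)
    (hRs : ∀ s : Finset (Fin 7), s.card = k - 1 → ∃ j < w, maskSet (RM.getD j 0) = s)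
    (e : Fin 7 → V) (he : Function.Injective e) (T : Finset (Finset V))
    (hT : ∀ t ∈ T, t.card = k ∧ t ⊆ Finset.univ.image e)
    (hdeg : ∀ r : Finset V, r.card = k - 1 → (T.filter (r ⊆ ·)).card ≠ 1)
    (hno : ∀ S ⊆ T, S.Nonempty → ∃ r : Finset V, r.card = k - 1 ∧ ¬ Even (S.filter (r ⊆ ·)).card)
    (x0 x1 x2 : ℕ) (l0 : x0 < 35) (l1 : x1 < 35) (l2 : x2 < 35)
    (h0 : (maskSet (FM.getD x0 0)).image e ∈ T) (h1 : (maskSet (FM.getD x1 0)).image e ∈ T)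
    (h2 : (maskSet (FM.getD x2 0)).image e ∈ T)
    (h01 : x0 ≠ x1) (h02 : x0 ≠ x2) (h12 : x1 ≠ x2)
    (h : startC mask (2 ^ w) (search mask (2 ^ w) R fuel)
      (.cons (w * (x0 + 2)) (BM.getD x0 0) (.cons (w * (x1 + 2)) (BM.getD x1 0)
        (.cons (w * (x2 + 2)) (BM.getD x2 0) .nil))) 0 0 M = true) : False := by
  classical
  have hinjM : ∀ a < 2 ^ 7, ∀ b < 2 ^ 7, maskSet a = maskSet b → a = b := by
    intro a ha b hb hab
    apply Nat.eq_of_testBit_eq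
    intro i
    by_cases hi : i < 7
    · have := congrArg (fun s => (⟨i, hi⟩ : Fin 7) ∈ s) hab
      simp only [maskSet, Finset.mem_filter, Finset.mem_univ, true_and, eq_iff_iff] at this
      exact Bool.eq_iff_iff.2 this
    · rw [Nat.testBit_eq_false_of_lt (ha.trans_le (Nat.pow_le_pow_right (by norm_num) (by omega))),
        Nat.testBit_eq_false_of_lt (hb.trans_le (Nat.pow_le_pow_right (by norm_num) (by omega)))]
  set g : ℕ → Finset V := fun x => (maskSet (FM.getD x 0)).image e with hg
  have himg : Function.Injective (Finset.image e) := Finset.image_injective he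
  have hginj : ∀ x < 35, ∀ y < 35, g x = g y → x = y := by
    intro x hx y hy hxy
    exact hFi x hx y hy (hinjM _ (hFl x hx) _ (hFl y hy) (himg hxy))
  have hgT : ∀ t ∈ T, ∃ y < 35, g y = t := by
    intro t ht
    obtain ⟨hc, hsub⟩ := hT t ht
    obtain ⟨s, _, rfl⟩ := Finset.subset_image_iff.1 hsub
    rw [Finset.card_image_of_injective _ he] at hc
    obtain ⟨y, hy, rfl⟩ := hF s hc
    exact ⟨y, hy, rfl⟩
  have hbit : ∀ x < 35, ∀ j, (BM.getD x 0).testBit j = true → j < w := by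
    intro x hx j hj
    by_contra hcon
    rw [Nat.testBit_eq_false_of_lt ((hBlt x hx).trans_le
      (Nat.pow_le_pow_right (by norm_num) (by omega)))] at hj
    exact absurd hj (by simp)
  have hsub : ∀ x < 35, ∀ j < w, ((BM.getD x 0).testBit j = true ↔
      (maskSet (RM.getD j 0)).image e ⊆ g x) := by
    intro x hx j hj
    rw [hbd x hx j hj, hg]
    exact (Finset.image_subset_image_iff he).symm
  set T' : Finset ℕ := (Finset.range 35).filter fun x => g x ∈ T with hT'
  have mT' : ∀ x, x ∈ T' ↔ x < 35 ∧ g x ∈ T := by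
    intro x; simp [hT']
  refine start_sound w mask M fuel (fun x => BM.getD x 0) T' R hw (fun x hx => ((mT' x).1 hx).1)
    hm0 hm hM hR ?_ ?_ x0 x1 x2 ((mT' _).2 ⟨l0, h0⟩) ((mT' _).2 ⟨l1, h1⟩) ((mT' _).2 ⟨l2, h2⟩)
    h01 h02 h12 h
  · intro I hI x hx hxI hmem
    obtain ⟨S, hS, hsum⟩ := mem_span_image (fun y => toVec (BM.getD y 0)) I _ hmem
    have hxS : x ∉ S := fun h => hxI (hS h)
    have hS' : ∀ y ∈ insert x S, y < 35 ∧ g y ∈ T := by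
      intro y hy
      rcases Finset.mem_insert.1 hy with rfl | hy
      · exact (mT' _).1 hx
      · exact (mT' _).1 (hI (hS hy))
    have hz : ∑ s ∈ insert x S, toVec (BM.getD s 0) = 0 := by
      rw [Finset.sum_insert hxS]
      have hsum' : toVec (BM.getD x 0) = ∑ s ∈ S, toVec (BM.getD s 0) := hsum
      rw [← hsum', vec_add_self]
    obtain ⟨r, hr, hodd⟩ := hno ((insert x S).image g) (by
      intro t ht
      obtain ⟨y, hy, rfl⟩ := Finset.mem_image.1 ht
      exact (hS' y hy).2) ((Finset.insert_nonempty _ _).image _)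
    apply hodd
    by_cases hre : r ⊆ Finset.univ.image e
    · obtain ⟨s, _, rfl⟩ := Finset.subset_image_iff.1 hre
      rw [Finset.card_image_of_injective _ he] at hr
      obtain ⟨j, hj, rfl⟩ := hRs s hr
      have hz' := congrFun hz j
      rw [Finset.sum_apply] at hz'
      have e1 : ((insert x S).image g).filter ((maskSet (RM.getD j 0)).image e ⊆ ·) =
          ((insert x S).filter fun y => (BM.getD y 0).testBit j = true).image g := by
        ext t
        simp only [Finset.mem_filter, Finset.mem_image]
        constructor
        · rintro ⟨⟨y, hy, rfl⟩, hyr⟩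
          exact ⟨y, ⟨hy, (hsub y (hS' y hy).1 j hj).2 hyr⟩, rfl⟩
        · rintro ⟨y, ⟨hy, hyr⟩, rfl⟩
          exact ⟨⟨y, hy, rfl⟩, (hsub y (hS' y hy).1 j hj).1 hyr⟩
      rw [e1, Finset.card_image_of_injOn]
      · rw [← ZMod.natCast_eq_zero_iff_even, ← Finset.sum_boole]
        exact hz'
      · intro a ha b hb hab
        simp only [Finset.coe_filter, Set.mem_ofPred_eq] at ha hb
        exact hginj a (hS' a ha.1).1 b (hS' b hb.1).1 hab
    · have : ((insert x S).image g).filter (r ⊆ ·) = ∅ := by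
        apply Finset.filter_eq_empty_iff.2
        intro t ht hrt
        obtain ⟨y, hy, rfl⟩ := Finset.mem_image.1 ht
        exact hre (hrt.trans (hT _ (hS' y hy).2).2)
      rw [this]; simp
  · intro x hx j hj
    obtain ⟨hx35, hxT⟩ := (mT' x).1 hx
    have hjw := hbit x hx35 j hj
    have hd := hdeg ((maskSet (RM.getD j 0)).image e) (by
      rw [Finset.card_image_of_injective _ he]; exact hRk j hjw)
    have hmem : g x ∈ T.filter ((maskSet (RM.getD j 0)).image e ⊆ ·) :=
      Finset.mem_filter.2 ⟨hxT, (hsub x hx35 j hjw).1 hj⟩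
    have hpos := Finset.card_pos.2 ⟨_, hmem⟩
    have hlt : 1 < (T.filter ((maskSet (RM.getD j 0)).image e ⊆ ·)).card := by omega
    obtain ⟨t, ht, hne⟩ := Finset.exists_mem_ne hlt (g x)
    obtain ⟨htT, htr⟩ := Finset.mem_filter.1 ht
    obtain ⟨y, hy, rfl⟩ := hgT t htT
    exact ⟨y, (mT' y).2 ⟨hy, htT⟩, fun h => hne (by rw [h]), (hsub y hy j hjw).2 htr⟩

theorem core3_aux {V : Type*} [DecidableEq V] 
    (e : Fin 7 → V) (he : Function.Injective e) (T : Finset (Finset V))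
    (hT : ∀ t ∈ T, t.card = 3 ∧ t ⊆ Finset.univ.image e)
    (hdeg : ∀ r : Finset V, r.card = 2 → (T.filter (r ⊆ ·)).card ≠ 1)
    (hno : ∀ S ⊆ T, S.Nonempty → ∃ r : Finset V, r.card = 2 ∧ ¬ Even (S.filter (r ⊆ ·)).card)
    (h0 : {e 0, e 1, e 2} ∈ T) (h1 : {e 0, e 1, e 3} ∈ T) (h2 : {e 0, e 1, e 4} ∈ T) : False := by
  have m0 : maskSet (facetMasks3.getD 0 0) = {0, 1, 2} := by decide +kernel
  have m1 : maskSet (facetMasks3.getD 1 0) = {0, 1, 3} := by decide +kernel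
  have m2 : maskSet (facetMasks3.getD 4 0) = {0, 1, 4} := by decide +kernel
  refine core_aux 3 21 colMask3 startMat3 21 facetMasks3 ridgeMasks3 bdMasks3 ridgeTree3
    (by norm_num) (by decide +kernel) (by decide +kernel) (by decide +kernel) (by decide +kernel)
    (by decide +kernel) (by decide +kernel) (by decide +kernel) (by decide +kernel)
    (by decide +kernel) (by decide +kernel) (by decide +kernel) e he T hT hdeg hno 0 1 4
    (by norm_num) (by norm_num) (by norm_num) ?_ ?_ ?_ (by norm_num) (by norm_num) (by norm_num)
    search_true3
  · rw [m0]; simpa [Finset.image_insert] using h0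
  · rw [m1]; simpa [Finset.image_insert] using h1
  · rw [m2]; simpa [Finset.image_insert] using h2

theorem core4_aux {V : Type*} [DecidableEq V] 
    (e : Fin 7 → V) (he : Function.Injective e) (T : Finset (Finset V))
    (hT : ∀ t ∈ T, t.card = 4 ∧ t ⊆ Finset.univ.image e)
    (hdeg : ∀ r : Finset V, r.card = 3 → (T.filter (r ⊆ ·)).card ≠ 1)
    (hno : ∀ S ⊆ T, S.Nonempty → ∃ r : Finset V, r.card = 3 ∧ ¬ Even (S.filter (r ⊆ ·)).card)
    (h0 : {e 0, e 1, e 2, e 3} ∈ T) (h1 : {e 0, e 1, e 2, e 4} ∈ T)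
    (h2 : {e 0, e 1, e 2, e 5} ∈ T) : False := by
  have m0 : maskSet (facetMasks4.getD 0 0) = {0, 1, 2, 3} := by decide +kernel
  have m1 : maskSet (facetMasks4.getD 1 0) = {0, 1, 2, 4} := by decide +kernel
  have m2 : maskSet (facetMasks4.getD 5 0) = {0, 1, 2, 5} := by decide +kernel
  refine core_aux 4 35 colMask4 startMat4 21 facetMasks4 ridgeMasks4 bdMasks4 ridgeTree4
    (by norm_num) (by decide +kernel) (by decide +kernel) (by decide +kernel) (by decide +kernel)
    (by decide +kernel) (by decide +kernel) (by decide +kernel) (by decide +kernel)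
    (by decide +kernel) (by decide +kernel) (by decide +kernel) e he T hT hdeg hno 0 1 5
    (by norm_num) (by norm_num) (by norm_num) ?_ ?_ ?_ (by norm_num) (by norm_num) (by norm_num)
    search_true4
  · rw [m0]; simpa [Finset.image_insert] using h0
  · rw [m1]; simpa [Finset.image_insert] using h1
  · rw [m2]; simpa [Finset.image_insert] using h2

/-- If a ridge has odd degree different from one, there are three facets on it. -/
theorem three_apexes {V : Type*} [DecidableEq V] (k : ℕ) (hk : 1 ≤ k) (T : Finset (Finset V))
    (hT : ∀ t ∈ T, t.card = k) (r : Finset V) (hr : r.card = k - 1)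
    (hodd : ¬ Even (T.filter (r ⊆ ·)).card) (h1 : (T.filter (r ⊆ ·)).card ≠ 1) :
    ∃ a b c : V, a ∉ r ∧ b ∉ r ∧ c ∉ r ∧ a ≠ b ∧ a ≠ c ∧ b ≠ c ∧
      insert a r ∈ T ∧ insert b r ∈ T ∧ insert c r ∈ T := by
  have h3 : 2 < (T.filter (r ⊆ ·)).card := by
    rw [Nat.not_even_iff_odd] at hodd
    obtain ⟨m, hm⟩ := hodd
    omega
  have hins : ∀ t ∈ T.filter (r ⊆ ·), ∃ a, a ∉ r ∧ insert a r = t ∧ insert a r ∈ T := by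
    intro t ht
    obtain ⟨htT, hrt⟩ := Finset.mem_filter.1 ht
    have hc : (t \ r).card = 1 := by
      rw [Finset.card_sdiff_of_subset hrt, hT t htT, hr]; omega
    obtain ⟨a, ha⟩ := Finset.card_eq_one.1 hc
    have ha' : a ∈ t \ r := by rw [ha]; simp
    have e : insert a r = t := by
      rw [Finset.insert_eq, ← ha, Finset.sdiff_union_of_subset hrt]
    exact ⟨a, (Finset.mem_sdiff.1 ha').2, e, e ▸ htT⟩
  obtain ⟨t0, t1, t2, m0, m1, m2, n01, n02, n12⟩ := Finset.two_lt_card_iff.1 h3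
  obtain ⟨a, ha, ea, haT⟩ := hins t0 m0
  obtain ⟨b, hb, eb, hbT⟩ := hins t1 m1
  obtain ⟨c, hc, ec, hcT⟩ := hins t2 m2
  refine ⟨a, b, c, ha, hb, hc, ?_, ?_, ?_, haT, hbT, hcT⟩
  · rintro rfl; exact n01 (ea.symm.trans eb)
  · rintro rfl; exact n02 (ea.symm.trans ec)
  · rintro rfl; exact n12 (eb.symm.trans ec)

theorem image_seven {V : Type*} [DecidableEq V] (a b c d u v w : V) :
    (Finset.univ : Finset (Fin 7)).image ![a, b, c, d, u, v, w] = {a, b, c, d, u, v, w} := by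
  rw [show (Finset.univ : Finset (Fin 7)) = {0, 1, 2, 3, 4, 5, 6} by decide]
  simp only [Finset.image_insert, Finset.image_singleton]
  rfl

theorem injective_seven {V : Type*} [DecidableEq V] (e : Fin 7 → V)
    (h : (Finset.univ.image e).card = 7) : Function.Injective e := by
  have : Set.InjOn e (Finset.univ : Finset (Fin 7)) :=
    Finset.card_image_iff.1 (by rw [h]; rfl)
  intro x y hxy
  exact this (by simp) (by simp) hxy

theorem core3 {V : Type*} [DecidableEq V] (W : Finset V) (hW : W.card = 7)
    (T : Finset (Finset V)) (hne : T.Nonempty) (hT : ∀ t ∈ T, t.card = 3 ∧ t ⊆ W)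
    (hno : ∀ S ⊆ T, S.Nonempty → ∃ r : Finset V, r.card = 2 ∧ ¬ Even (S.filter (r ⊆ ·)).card) :
    ∃ r : Finset V, r.card = 2 ∧ (T.filter (r ⊆ ·)).card = 1 := by
  by_contra! hdeg
  obtain ⟨r, hr, hodd⟩ := hno T subset_rfl hne
  obtain ⟨a, b, c, ha, hb, hc, hab, hac, hbc, haT, hbT, hcT⟩ :=
    three_apexes 3 (by norm_num) T (fun t ht => (hT t ht).1) r hr hodd (hdeg r hr)
  have hsub : insert a (insert b (insert c r)) ⊆ W := by
    intro v hv
    simp only [Finset.mem_insert] at hv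
    rcases hv with rfl | rfl | rfl | hv
    · exact (hT _ haT).2 (by simp)
    · exact (hT _ hbT).2 (by simp)
    · exact (hT _ hcT).2 (by simp)
    · exact (hT _ haT).2 (by simp [hv])
  have hcard : (insert a (insert b (insert c r))).card = 5 := by
    rw [Finset.card_insert_of_notMem (by simp [hab, hac, ha]),
      Finset.card_insert_of_notMem (by simp [hbc, hb]), Finset.card_insert_of_notMem hc, hr]
  have hrest : (W \ insert a (insert b (insert c r))).card = 2 := by
    rw [Finset.card_sdiff_of_subset hsub, hW, hcard]
  obtain ⟨p, q, _, hpq⟩ := Finset.card_eq_two.1 hrest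
  obtain ⟨u, v, _, rfl⟩ := Finset.card_eq_two.1 hr
  have hWe : W = Finset.univ.image ![u, v, a, b, c, p, q] := by
    rw [image_seven, ← Finset.sdiff_union_of_subset hsub, hpq]
    ext z
    simp only [Finset.mem_union, Finset.mem_insert, Finset.mem_singleton]
    grind
  have hinj : Function.Injective ![u, v, a, b, c, p, q] := by
    apply injective_seven
    rw [← hWe, hW]
  refine core3_aux ![u, v, a, b, c, p, q] hinj T (fun t ht => ?_) hdeg hno ?_ ?_ ?_
  · rw [← hWe]; exact hT t ht
  · have : ({u, v, a} : Finset V) = insert a {u, v} := by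
      ext z; simp only [Finset.mem_insert, Finset.mem_singleton]; grind
    change ({u, v, a} : Finset V) ∈ T
    rw [this]; exact haT
  · have : ({u, v, b} : Finset V) = insert b {u, v} := by
      ext z; simp only [Finset.mem_insert, Finset.mem_singleton]; grind
    change ({u, v, b} : Finset V) ∈ T
    rw [this]; exact hbT
  · have : ({u, v, c} : Finset V) = insert c {u, v} := by
      ext z; simp only [Finset.mem_insert, Finset.mem_singleton]; grind
    change ({u, v, c} : Finset V) ∈ T
    rw [this]; exact hcT

theorem core4 {V : Type*} [DecidableEq V] (W : Finset V) (hW : W.card = 7)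
    (T : Finset (Finset V)) (hne : T.Nonempty) (hT : ∀ t ∈ T, t.card = 4 ∧ t ⊆ W)
    (hno : ∀ S ⊆ T, S.Nonempty → ∃ r : Finset V, r.card = 3 ∧ ¬ Even (S.filter (r ⊆ ·)).card) :
    ∃ r : Finset V, r.card = 3 ∧ (T.filter (r ⊆ ·)).card = 1 := by
  by_contra! hdeg
  obtain ⟨r, hr, hodd⟩ := hno T subset_rfl hne
  obtain ⟨a, b, c, ha, hb, hc, hab, hac, hbc, haT, hbT, hcT⟩ :=
    three_apexes 4 (by norm_num) T (fun t ht => (hT t ht).1) r hr hodd (hdeg r hr)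
  have hsub : insert a (insert b (insert c r)) ⊆ W := by
    intro v hv
    simp only [Finset.mem_insert] at hv
    rcases hv with rfl | rfl | rfl | hv
    · exact (hT _ haT).2 (by simp)
    · exact (hT _ hbT).2 (by simp)
    · exact (hT _ hcT).2 (by simp)
    · exact (hT _ haT).2 (by simp [hv])
  have hcard : (insert a (insert b (insert c r))).card = 6 := by
    rw [Finset.card_insert_of_notMem (by simp [hab, hac, ha]),
      Finset.card_insert_of_notMem (by simp [hbc, hb]), Finset.card_insert_of_notMem hc, hr]
  have hrest : (W \ insert a (insert b (insert c r))).card = 1 := by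
    rw [Finset.card_sdiff_of_subset hsub, hW, hcard]
  obtain ⟨p, hpq⟩ := Finset.card_eq_one.1 hrest
  obtain ⟨u, v, x, _, _, _, rfl⟩ := Finset.card_eq_three.1 hr
  have hWe : W = Finset.univ.image ![u, v, x, a, b, c, p] := by
    rw [image_seven, ← Finset.sdiff_union_of_subset hsub, hpq]
    ext z
    simp only [Finset.mem_union, Finset.mem_insert, Finset.mem_singleton]
    grind
  have hinj : Function.Injective ![u, v, x, a, b, c, p] := by
    apply injective_seven
    rw [← hWe, hW]
  refine core4_aux ![u, v, x, a, b, c, p] hinj T (fun t ht => ?_) hdeg hno ?_ ?_ ?_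
  · rw [← hWe]; exact hT t ht
  · have : ({u, v, x, a} : Finset V) = insert a {u, v, x} := by
      ext z; simp only [Finset.mem_insert, Finset.mem_singleton]; grind
    change ({u, v, x, a} : Finset V) ∈ T
    rw [this]; exact haT
  · have : ({u, v, x, b} : Finset V) = insert b {u, v, x} := by
      ext z; simp only [Finset.mem_insert, Finset.mem_singleton]; grind
    change ({u, v, x, b} : Finset V) ∈ T
    rw [this]; exact hbT
  · have : ({u, v, x, c} : Finset V) = insert c {u, v, x} := by
      ext z; simp only [Finset.mem_insert, Finset.mem_singleton]; grind
    change ({u, v, x, c} : Finset V) ∈ T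
    rw [this]; exact hcT

end FreeFaceSearch

namespace HomologySpheres

theorem subset_verts {V : Type*} [DecidableEq V] {K : Finset (Finset V)} {s : Finset V}
    (hs : s ∈ K) : s ⊆ verts K := by
  have : id s ≤ K.sup id := Finset.le_sup hs
  exact this

/-- The boundary operator relative to an ambient vertex set. -/
def bdW {V : Type*} [DecidableEq V] (W : Finset V) (c : Finset V → ZMod 2) :
    Finset V → ZMod 2 :=
  fun t => ∑ v ∈ W \ t, c (insert v t)

theorem z2bdry_eq {V : Type*} [DecidableEq V] {K : Finset (Finset V)} {n : ℕ}
    {c : Finset V → ZMod 2} (hc : z2chainOK K n c) (W : Finset V) (hW : verts K ⊆ W) :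
    z2bdry K c = bdW W c := by
  funext t
  unfold z2bdry bdW
  apply Finset.sum_subset (Finset.sdiff_subset_sdiff hW subset_rfl)
  intro v hv hv'
  by_contra hne
  rcases (hc _ hne).2 with h | h
  · have := subset_verts h (Finset.mem_insert_self v t)
    exact hv' (Finset.mem_sdiff.2 ⟨this, (Finset.mem_sdiff.1 hv).2⟩)
  · exact Finset.insert_ne_empty _ _ h

theorem bdW_add {V : Type*} [DecidableEq V] (W : Finset V) (c d : Finset V → ZMod 2) :
    bdW W (c + d) = bdW W c + bdW W d := by
  funext t
  simp [bdW, Finset.sum_add_distrib]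

theorem bdW_bdW {V : Type*} [DecidableEq V] (W : Finset V) (c : Finset V → ZMod 2) :
    bdW W (bdW W c) = 0 := by
  funext t
  simp only [bdW, Pi.zero_apply]
  rw [Finset.sum_sigma']
  refine Finset.sum_involution (fun p _ => ⟨p.2, p.1⟩) ?_ ?_ ?_ ?_
  · rintro ⟨u, v⟩ h
    simp only
    rw [Finset.insert_comm]
    exact CharTwo.add_self_eq_zero _
  · rintro ⟨u, v⟩ h _ heq
    simp only [Finset.mem_sigma, Finset.mem_sdiff, Finset.mem_insert, not_or] at h
    simp only [Sigma.mk.injEq, heq_eq_eq] at heq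
    exact h.2.2.1 heq.1
  · rintro ⟨u, v⟩ h
    simp only [Finset.mem_sigma, Finset.mem_sdiff, Finset.mem_insert, not_or] at h ⊢
    exact ⟨⟨h.2.1, h.2.2.2⟩, h.1.1, fun e => h.2.2.1 e.symm, h.1.2⟩
  · rintro ⟨u, v⟩ h
    rfl

/-- Boundary at `t` of the indicator of a family of sets. -/
theorem bdW_indicator {V : Type*} [DecidableEq V] (W : Finset V) (S : Finset (Finset V))
    (hS : ∀ s ∈ S, s ⊆ W) (t : Finset V) (ht : ∀ s ∈ S, t ⊆ s → s.card = t.card + 1) :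
    bdW W (fun s => if s ∈ S then 1 else 0) t = ((S.filter (t ⊆ ·)).card : ZMod 2) := by
  unfold bdW
  rw [Finset.sum_boole]
  congr 1
  have : S.filter (t ⊆ ·) = ((W \ t).filter fun v => insert v t ∈ S).image fun v => insert v t := by
    ext s
    simp only [Finset.mem_filter, Finset.mem_image, Finset.mem_sdiff]
    constructor
    · rintro ⟨hs, hts⟩
      have hc : (s \ t).card = 1 := by
        rw [Finset.card_sdiff_of_subset hts, ht s hs hts]; omega
      obtain ⟨v, hv⟩ := Finset.card_eq_one.1 hc
      have hv' : v ∈ s \ t := by rw [hv]; simp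
      have e : insert v t = s := by
        rw [Finset.insert_eq, ← hv, Finset.sdiff_union_of_subset hts]
      rw [Finset.mem_sdiff] at hv'
      exact ⟨v, ⟨⟨hS s hs hv'.1, hv'.2⟩, e ▸ hs⟩, e⟩
    · rintro ⟨v, ⟨_, hv⟩, rfl⟩
      exact ⟨hv, Finset.subset_insert _ _⟩
  rw [this, Finset.card_image_of_injOn]
  intro u hu v hv huv
  simp only [Finset.coe_filter, Finset.mem_sdiff, Set.mem_ofPred_eq] at hu hv
  have h1 : u ∈ insert v t := by
    have : u ∈ insert u t := Finset.mem_insert_self _ _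
    simp only at huv
    rwa [huv] at this
  rcases Finset.mem_insert.1 h1 with h | h
  · exact h
  · exact absurd h hu.1.2

/-- Top-dimensional cycles vanish. -/
theorem top_cycle {V : Type*} [DecidableEq V] {K : Finset (Finset V)} (hac : Z2Acyclic K)
    (n : ℕ) (hn : ∀ s ∈ K, s.card ≤ n) (c : Finset V → ZMod 2) (hc : z2chainOK K n c)
    (hcyc : bdW (verts K) c = 0) : c = 0 := by
  obtain ⟨c', hc', rfl⟩ := hac n c hc hcyc
  have : c' = 0 := by
    funext s
    by_contra hne
    obtain ⟨h1, h2 | h2⟩ := hc' s hne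
    · have := hn s h2; omega
    · subst h2; simp at h1
  subst this
  funext t
  simp [z2bdry]

theorem no_even {V : Type*} [DecidableEq V] {K : Finset (Finset V)} (hac : Z2Acyclic K)
    (k : ℕ) (hk : 1 ≤ k) (hn : ∀ s ∈ K, s.card ≤ k) (S : Finset (Finset V))
    (hS : S ⊆ K.filter fun s => s.card = k) (hne : S.Nonempty) :
    ∃ r : Finset V, r.card = k - 1 ∧ ¬ Even (S.filter (r ⊆ ·)).card := by
  by_contra! hcon
  have hS' : ∀ s ∈ S, s ∈ K ∧ s.card = k := fun s hs => Finset.mem_filter.1 (hS hs)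
  have h0 := top_cycle hac k hn (fun s => if s ∈ S then 1 else 0) (by
    intro s hs
    simp only [ne_eq, ite_eq_right_iff, one_ne_zero, imp_false, not_not] at hs
    exact ⟨(hS' s hs).2, Or.inl (hS' s hs).1⟩) (by
    funext t
    by_cases ht : t.card = k - 1
    · rw [bdW_indicator _ S (fun s hs => subset_verts (hS' s hs).1) t
        (fun s hs _ => by rw [(hS' s hs).2, ht]; omega)]
      exact (ZMod.natCast_eq_zero_iff_even).2 (hcon t ht)
    · apply Finset.sum_eq_zero
      intro v hv
      refine if_neg ?_
      intro hmem
      have := (hS' _ hmem).2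
      rw [Finset.card_insert_of_notMem (Finset.mem_sdiff.1 hv).2] at this
      omega)
  obtain ⟨s, hs⟩ := hne
  have := congrFun h0 s
  simp [hs] at this

theorem free_of_degree {V : Type*} [DecidableEq V] {K : Finset (Finset V)} (hK : IsComplex K)
    (k : ℕ) (hk : 2 ≤ k) (hn : ∀ s ∈ K, s.card ≤ k) (r : Finset V) (hr : r.card = k - 1)
    (h1 : ((K.filter fun s => s.card = k).filter (r ⊆ ·)).card = 1) :
    ∃ σ, IsFreeFace K r σ := by
  obtain ⟨σ, hσ⟩ := Finset.card_eq_one.1 h1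
  have hm : ∀ ρ, (ρ ∈ K ∧ ρ.card = k) ∧ r ⊆ ρ ↔ ρ = σ := by
    intro ρ
    have := Finset.ext_iff.1 hσ ρ
    simpa only [Finset.mem_filter, Finset.mem_singleton] using this
  obtain ⟨⟨hσK, hσc⟩, hrσ⟩ := (hm σ).2 rfl
  refine ⟨σ, hK.2.2 σ hσK r hrσ (Finset.card_pos.1 (by omega)), hσK, ?_, ?_⟩
  · refine hrσ.ssubset_of_ne ?_
    rintro rfl; omega
  · intro ρ hρ hrρ
    have h2 := Finset.card_lt_card hrρ
    have h3 := hn ρ hρ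
    exact (hm ρ).1 ⟨⟨hρ, by omega⟩, hrρ.1⟩

/-- An acyclic graph with an edge has a leaf. -/
theorem core2 {V : Type*} [DecidableEq V] {K : Finset (Finset V)} (hac : Z2Acyclic K)
    (hn : ∀ s ∈ K, s.card ≤ 2) (hne : (K.filter fun s => s.card = 2).Nonempty) :
    ∃ r : Finset V, r.card = 1 ∧ ((K.filter fun s => s.card = 2).filter (r ⊆ ·)).card = 1 := by
  classical
  by_contra! hdeg
  set T := K.filter fun s => s.card = 2 with hT
  have mT : ∀ t ∈ T, t ∈ K ∧ t.card = 2 := fun t ht => Finset.mem_filter.1 ht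
  set U := T.sup id with hU
  have hTU : ∀ t ∈ T, t ⊆ U := by
    intro t ht
    have : id t ≤ T.sup id := Finset.le_sup ht
    exact this
  -- counting
  have hcount : U.card ≤ T.card := by
    have h1 : ∑ u ∈ U, (T.filter (fun t => u ∈ t)).card = ∑ t ∈ T, (U.filter (fun u => u ∈ t)).card :=
      Finset.sum_card_bipartiteAbove_eq_sum_card_bipartiteBelow (fun u t => u ∈ t)
    have h2 : ∑ t ∈ T, (U.filter (fun u => u ∈ t)).card = T.card * 2 := by
      rw [Finset.sum_const_nat]
      intro t ht
      rw [Finset.filter_mem_eq_inter, Finset.inter_eq_right.2 (hTU t ht)]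
      exact (mT t ht).2
    have h3 : U.card * 2 ≤ ∑ u ∈ U, (T.filter (fun t => u ∈ t)).card := by
      rw [← smul_eq_mul]
      apply Finset.card_nsmul_le_sum
      intro u hu
      have h4 := hdeg {u} (by simp)
      simp only [Finset.singleton_subset_iff] at h4
      obtain ⟨t, ht, hut⟩ := Finset.mem_sup.1 hu
      have : 0 < (T.filter (fun t => u ∈ t)).card :=
        Finset.card_pos.2 ⟨t, Finset.mem_filter.2 ⟨ht, hut⟩⟩
      omega
    omega
  obtain ⟨t0, ht0⟩ := hne
  obtain ⟨u0, hu0⟩ : ∃ u, u ∈ t0 := by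
    apply Finset.card_pos.1
    rw [(mT t0 ht0).2]; norm_num
  have hu0U : u0 ∈ U := hTU t0 ht0 hu0
  -- extension by zero
  let ext : (T → ZMod 2) → Finset V → ZMod 2 := fun c s => if h : s ∈ T then c ⟨s, h⟩ else 0
  let L : (T → ZMod 2) →ₗ[ZMod 2] (↥(U.erase u0) → ZMod 2) :=
    { toFun := fun c u => bdW (verts K) (ext c) {(u : V)}
      map_add' := by
        intro a b
        funext u
        have : ext (a + b) = ext a + ext b := by
          funext s
          simp only [ext, Pi.add_apply]
          split <;> simp
        simp only [this, bdW_add, Pi.add_apply]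
      map_smul' := by
        intro m a
        funext u
        have : ext (m • a) = fun s => m * ext a s := by
          funext s
          simp only [ext, Pi.smul_apply, smul_eq_mul]
          split <;> simp
        simp only [this, bdW, RingHom.id_apply, Pi.smul_apply, smul_eq_mul, Finset.mul_sum] }
  have hker : LinearMap.ker L ≠ ⊥ := by
    apply LinearMap.ker_ne_bot_of_finrank_lt
    simp only [Module.finrank_fintype_fun_eq_card, Fintype.card_coe]
    rw [Finset.card_erase_of_mem hu0U]
    have := Finset.card_pos.2 ⟨u0, hu0U⟩
    omega
  obtain ⟨c, hcL, hc0⟩ := (Submodule.ne_bot_iff _).1 hker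
  have hext : ∀ s, ext c s ≠ 0 → s ∈ T := by
    intro s hs
    by_contra h
    exact hs (by simp only [ext, dif_neg h])
  have hz : ∀ u, u ≠ u0 → bdW (verts K) (ext c) {u} = 0 := by
    intro u hu
    by_cases huU : u ∈ U
    · exact congrFun (LinearMap.mem_ker.1 hcL) ⟨u, Finset.mem_erase.2 ⟨hu, huU⟩⟩
    · apply Finset.sum_eq_zero
      intro v _
      by_contra hne
      exact huU (hTU _ (hext _ hne) (by simp))
  have hu0K : u0 ∈ verts K := subset_verts (mT t0 ht0).1 hu0
  have hz0 : bdW (verts K) (ext c) {u0} = 0 := by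
    have h := congrFun (bdW_bdW (verts K) (ext c)) ∅
    have h' : ∑ v ∈ verts K \ ∅, bdW (verts K) (ext c) (insert v ∅) = 0 := h
    rw [Finset.sum_eq_single u0] at h'
    · exact h'
    · intro v _ hv
      exact hz v hv
    · intro hcon
      exact absurd hu0K (by simpa using hcon)
  have h0 := top_cycle hac 2 hn (ext c) (fun s hs => ⟨(mT s (hext s hs)).2,
      Or.inl (mT s (hext s hs)).1⟩) (by
    funext t
    by_cases ht : t.card = 1
    · obtain ⟨u, rfl⟩ := Finset.card_eq_one.1 ht
      by_cases hu : u = u0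
      · subst hu; exact hz0
      · exact hz u hu
    · apply Finset.sum_eq_zero
      intro v hv
      by_contra hne
      have := (mT _ (hext _ hne)).2
      rw [Finset.card_insert_of_notMem (Finset.mem_sdiff.1 hv).2] at this
      omega)
  apply hc0
  funext ⟨s, hs⟩
  have := congrFun h0 s
  simpa only [ext, dif_pos hs, Pi.zero_apply] using this

/-- An acyclic complex of dimension zero is a point. -/
theorem point_of_dim_zero {V : Type*} [DecidableEq V] {K : Finset (Finset V)} (hK : IsComplex K)
    (hac : Z2Acyclic K) (hn : ∀ s ∈ K, s.card ≤ 1) : ∃ v, K = {{v}} := by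
  have h1 : ∀ s ∈ K, ∃ v, s = {v} := by
    intro s hs
    apply Finset.card_eq_one.1
    have h2 := hn s hs
    have h3 : s ≠ ∅ := fun h => hK.2.1 (h ▸ hs)
    have := Finset.card_pos.2 (Finset.nonempty_iff_ne_empty.2 h3)
    omega
  have huniq : ∀ s ∈ K, ∀ t ∈ K, s = t := by
    intro s hs t ht
    by_contra hst
    obtain ⟨r, hr, hodd⟩ := no_even hac 1 le_rfl hn {s, t} (by
      intro x hx
      simp only [Finset.mem_insert, Finset.mem_singleton] at hx
      rcases hx with rfl | rfl
      · obtain ⟨v, rfl⟩ := h1 _ hs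
        simp [hs]
      · obtain ⟨v, rfl⟩ := h1 _ ht
        simp [ht]) (by simp)
    have hr0 : r = ∅ := Finset.card_eq_zero.1 (by simpa using hr)
    subst hr0
    apply hodd
    simp [hst]
  obtain ⟨s, hs⟩ := hK.1
  obtain ⟨v, rfl⟩ := h1 s hs
  refine ⟨v, ?_⟩
  ext t
  rw [Finset.mem_singleton]
  exact ⟨fun ht => huniq t ht _ hs, fun h => h ▸ hs⟩

theorem free_face_card {V : Type*} [DecidableEq V] {K : Finset (Finset V)} (hK : IsComplex K)
    {τ σ : Finset V} (h : IsFreeFace K τ σ) : ∃ v, v ∉ τ ∧ insert v τ = σ := by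
  obtain ⟨hτ, hσ, hss, hu⟩ := h
  obtain ⟨v, hvσ, hvτ⟩ := Finset.exists_of_ssubset hss
  refine ⟨v, hvτ, hu _ (hK.2.2 σ hσ _ (Finset.insert_subset hvσ hss.1) (by simp)) ?_⟩
  exact Finset.ssubset_insert hvτ

theorem collapse_complex {V : Type*} [DecidableEq V] {K K' : Finset (Finset V)} (hK : IsComplex K)
    {τ σ : Finset V} (h : IsFreeFace K τ σ)
    (hK' : ∀ ρ, ρ ∈ K' ↔ ρ ≠ σ ∧ ρ ≠ τ ∧ ρ ∈ K) : IsComplex K' := by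
  obtain ⟨v, hv, hσ⟩ := free_face_card hK h
  obtain ⟨hτK, hσK, hss, hu⟩ := h
  have hτne : τ.Nonempty := Finset.nonempty_iff_ne_empty.2 fun h => hK.2.1 (h ▸ hτK)
  refine ⟨⟨{v}, (hK' _).2 ⟨?_, ?_, ?_⟩⟩, fun h => hK.2.1 ((hK' _).1 h).2.2, ?_⟩
  · rintro h
    have h1 : σ.card = τ.card + 1 := by rw [← hσ, Finset.card_insert_of_notMem hv]
    have h2 := Finset.card_pos.2 hτne
    rw [← h] at h1
    simp at h1
    subst h1
    simp at hτne
  · rintro rfl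
    simp at hv
  · exact hK.2.2 σ hσK _ (by rw [← hσ]; simp) (by simp)
  · intro s hs t hts htne
    obtain ⟨hs1, hs2, hsK⟩ := (hK' s).1 hs
    refine (hK' t).2 ⟨?_, ?_, hK.2.2 s hsK t hts htne⟩
    · rintro rfl
      exact hs1 (hu s hsK (hss.trans_subset hts))
    · rintro rfl
      exact hs1 (hu s hsK (hts.ssubset_of_ne (Ne.symm hs2)))

theorem collapse_acyclic {V : Type*} [DecidableEq V] {K K' : Finset (Finset V)} (hK : IsComplex K)
    {τ σ : Finset V} (h : IsFreeFace K τ σ)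
    (hK' : ∀ ρ, ρ ∈ K' ↔ ρ ≠ σ ∧ ρ ≠ τ ∧ ρ ∈ K) (hac : Z2Acyclic K) : Z2Acyclic K' := by
  obtain ⟨v, hv, hσ⟩ := free_face_card hK h
  obtain ⟨hτK, hσK, hss, hu⟩ := h
  have hcard : σ.card = τ.card + 1 := by rw [← hσ, Finset.card_insert_of_notMem hv]
  have hτne : τ ≠ ∅ := fun h => hK.2.1 (h ▸ hτK)
  have hσne : σ ≠ ∅ := fun h => hK.2.1 (h ▸ hσK)
  have hvK : v ∈ verts K := subset_verts hσK (by rw [← hσ]; simp)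
  have hverts : verts K' ⊆ verts K := by
    intro u hu
    obtain ⟨s, hs, hus⟩ := Finset.mem_sup.1 hu
    exact subset_verts ((hK' s).1 hs).2.2 hus
  have hOK : ∀ n c, z2chainOK K' n c → z2chainOK K n c := by
    intro n c hc s hs
    obtain ⟨h1, h2⟩ := hc s hs
    refine ⟨h1, h2.imp (fun h => ((hK' s).1 h).2.2) id⟩
  have hOK' : ∀ n c, z2chainOK K n c → c τ = 0 → c σ = 0 → z2chainOK K' n c := by
    intro n c hc hτ hσ s hs
    obtain ⟨h1, h2⟩ := hc s hs
    refine ⟨h1, h2.imp (fun h => (hK' s).2 ⟨?_, ?_, h⟩) id⟩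
    · rintro rfl; exact hs hσ
    · rintro rfl; exact hs hτ
  -- the boundary at `τ` sees only `σ`
  have hbτ : ∀ n c, z2chainOK K n c → bdW (verts K) c τ = c σ := by
    intro n c hc
    unfold bdW
    rw [Finset.sum_eq_single v, hσ]
    · intro u hu' huv
      by_contra hne
      rcases (hc _ hne).2 with h1 | h1
      · have h2 := hu _ h1 (Finset.ssubset_insert (Finset.mem_sdiff.1 hu').2)
        have h3 : u ∈ insert v τ := by rw [hσ, ← h2]; simp
        rcases Finset.mem_insert.1 h3 with h4 | h4
        · exact huv h4
        · exact (Finset.mem_sdiff.1 hu').2 h4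
      · exact Finset.insert_ne_empty _ _ h1
    · intro hcon
      exact absurd (Finset.mem_sdiff.2 ⟨hvK, hv⟩) hcon
  intro n c hc hcyc
  have hcK := hOK n c hc
  rw [z2bdry_eq hc _ hverts] at hcyc
  obtain ⟨c', hc', hbd⟩ := hac n c hcK (by rw [z2bdry_eq hcK _ subset_rfl]; exact hcyc)
  rw [z2bdry_eq hc' _ subset_rfl] at hbd
  have hcτ : c τ = 0 := by
    by_contra hne
    rcases (hc τ hne).2 with h1 | h1
    · exact ((hK' τ).1 h1).2.1 rfl
    · exact hτne h1
  have hc'σ : c' σ = 0 := by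
    rw [← hbτ (n + 1) c' hc', hbd, hcτ]
  by_cases hc'τ : c' τ = 0
  · have h1 := hOK' _ _ hc' hc'τ hc'σ
    exact ⟨c', h1, by rw [z2bdry_eq h1 _ hverts, hbd]⟩
  · have hn : τ.card = n + 1 := (hc' τ hc'τ).1
    set d : Finset V → ZMod 2 := fun s => if s = σ then 1 else 0 with hd
    have hdOK : z2chainOK K (n + 2) d := by
      intro s hs
      have : s = σ := by
        by_contra hne
        exact hs (by simp [hd, hne])
      subst this
      exact ⟨by omega, Or.inl hσK⟩
    have hbdOK : z2chainOK K (n + 1) (bdW (verts K) d) := by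
      intro s hs
      obtain ⟨u, hu1, hu2⟩ := Finset.exists_ne_zero_of_sum_ne_zero hs
      obtain ⟨h1, _⟩ := hdOK _ hu2
      rw [Finset.card_insert_of_notMem (Finset.mem_sdiff.1 hu1).2] at h1
      refine ⟨by omega, ?_⟩
      have h3 : insert u s = σ := by
        by_contra hne
        exact hu2 (by simp [hd, hne])
      refine Or.inl (hK.2.2 σ hσK s ?_ (Finset.card_pos.1 (by omega)))
      rw [← h3]; exact Finset.subset_insert _ _
    have hone : c' τ = 1 := by
      have : ∀ a : ZMod 2, a ≠ 0 → a = 1 := by decide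
      exact this _ hc'τ
    have hsum : z2chainOK K (n + 1) (c' + bdW (verts K) d) := by
      intro s hs
      by_cases h1 : c' s = 0
      · apply hbdOK
        intro h2
        exact hs (by simp [h1, h2])
      · exact hc' s h1
    have h1 : z2chainOK K' (n + 1) (c' + bdW (verts K) d) := by
      apply hOK' _ _ hsum
      · rw [Pi.add_apply, hbτ _ _ hdOK, hone]
        simp only [hd, if_pos]
        decide
      · by_contra hne
        have := (hsum _ hne).1
        omega
    refine ⟨_, h1, ?_⟩
    rw [z2bdry_eq h1 _ hverts, bdW_add, bdW_bdW, hbd, add_zero]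

/-- Every acyclic complex on at most seven vertices of dimension at most three which is not
a point has a free face. -/
theorem exists_free {V : Type*} [DecidableEq V] (W : Finset V) (hW : W.card = 7)
    {K : Finset (Finset V)} (hK : IsComplex K) (hac : Z2Acyclic K) (hKW : verts K ⊆ W)
    (hn : ∀ s ∈ K, s.card ≤ 4) : (∃ v, K = {{v}}) ∨ ∃ τ σ, IsFreeFace K τ σ := by
  have hsub : ∀ s ∈ K, s ⊆ W := fun s hs => (subset_verts hs).trans hKW
  have down : ∀ k, (∀ s ∈ K, s.card ≤ k + 1) → ¬ (K.filter fun s => s.card = k + 1).Nonempty →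
      ∀ s ∈ K, s.card ≤ k := by
    intro k h1 h2 s hs
    have h3 := h1 s hs
    have h4 : s.card ≠ k + 1 := fun h => h2 ⟨s, Finset.mem_filter.2 ⟨hs, h⟩⟩
    omega
  by_cases h4 : (K.filter fun s => s.card = 4).Nonempty
  · right
    obtain ⟨r, hr, h1⟩ := FreeFaceSearch.core4 W hW _ h4
      (fun t ht => ⟨(Finset.mem_filter.1 ht).2, hsub t (Finset.mem_filter.1 ht).1⟩)
      (fun S hS hne => no_even hac 4 (by norm_num) hn S hS hne)
    exact ⟨r, free_of_degree hK 4 (by norm_num) hn r hr h1⟩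
  have hn3 := down 3 hn h4
  by_cases h3 : (K.filter fun s => s.card = 3).Nonempty
  · right
    obtain ⟨r, hr, h1⟩ := FreeFaceSearch.core3 W hW _ h3
      (fun t ht => ⟨(Finset.mem_filter.1 ht).2, hsub t (Finset.mem_filter.1 ht).1⟩)
      (fun S hS hne => no_even hac 3 (by norm_num) hn3 S hS hne)
    exact ⟨r, free_of_degree hK 3 (by norm_num) hn3 r hr h1⟩
  have hn2 := down 2 hn3 h3
  by_cases h2 : (K.filter fun s => s.card = 2).Nonempty
  · right
    obtain ⟨r, hr, h1⟩ := core2 hac hn2 h2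
    exact ⟨r, free_of_degree hK 2 (by norm_num) hn2 r hr h1⟩
  exact Or.inl (point_of_dim_zero hK hac (down 1 hn2 h2))

theorem collapsible_aux {V : Type*} [DecidableEq V] (W : Finset V) (hW : W.card = 7) (n : ℕ) :
    ∀ K : Finset (Finset V), K.card ≤ n → IsComplex K → Z2Acyclic K → verts K ⊆ W →
      (∀ s ∈ K, s.card ≤ 4) → Collapsible K := by
  induction n with
  | zero =>
    intro K hc hK _ _ _
    have := Finset.card_pos.2 hK.1
    omega
  | succ n ih =>
    intro K hc hK hac hKW hn
    rcases exists_free W hW hK hac hKW hn with ⟨v, rfl⟩ | ⟨τ, σ, hfree⟩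
    · exact ⟨v, Relation.ReflTransGen.refl⟩
    · obtain ⟨K', hK', hmem⟩ : ∃ K', ElemCollapse K K' ∧
          ∀ ρ, ρ ∈ K' ↔ ρ ≠ σ ∧ ρ ≠ τ ∧ ρ ∈ K :=
        ⟨_, ⟨τ, σ, hfree, rfl⟩, fun ρ => by rw [Finset.mem_erase, Finset.mem_erase]⟩
      have hsubK : K' ⊆ K := fun ρ hρ => ((hmem ρ).1 hρ).2.2
      have hlt : K'.card < K.card := by
        apply Finset.card_lt_card
        refine hsubK.ssubset_of_ne ?_
        rintro rfl
        exact ((hmem τ).1 hfree.1).2.1 rfl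
      obtain ⟨v, hv⟩ := ih K' (by omega) (collapse_complex hK hfree hmem)
        (collapse_acyclic hK hfree hmem hac)
        ((Finset.sup_mono hsubK).trans hKW) (fun s hs => hn s (hsubK hs))
      exact ⟨v, Relation.ReflTransGen.head hK' hv⟩

end HomologySpheres

noncomputable section

attribute [local instance] Classical.propDecidable

namespace HomologySpheres

variable {V : Type*} [DecidableEq V] {W : Type*} [DecidableEq W]

/-- Lemma 3.5: every 7-vertex 3-dimensional `ℤ/2`-acyclic
simplicial complex is collapsible. -/
theorem seven_vertex_three_dim_acyclic_collapsible {V : Type*} [DecidableEq V]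
    (X : Finset (Finset V)) (hX : IsComplex X) (h7 : (verts X).card = 7)
    (hdim : X.sup Finset.card = 4) (hac : Z2Acyclic X) :
    Collapsible X := by
  refine collapsible_aux (verts X) h7 X.card X le_rfl hX hac subset_rfl ?_
  intro s hs
  rw [← hdim]
  exact Finset.le_sup (f := Finset.card) hs

end HomologySpheres
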